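/- arXiv:1406.0421 — 6 statements merged into one kernel-verified Lean document; each statement's English description precedes it below -/
import Mathlib

section
/- Let k be a commutative ring, let Λ = ℕ^r for some r ≥ 1, fix c ∈ k^× and biadditive maps χ', χ'': Λ×Λ → ℤ. Suppose H = ⊕_{λ∈Λ} H_λ is a Λ-graded k-module equipped with: (i) a Λ-graded associative unital algebra structure with multiplication ∇ and unit η: k → H_0 (so ∇(H_λ ⊗ H_μ) ⊆ H_{λ+μ}); (ii) a Λ-graded coassociative counital coalgebra structure with comultiplication Δ and counit ε, satisfying Δ(H_λ) ⊆ ⊕_{μ+ν=λ} H_μ ⊗ H_ν and ε(H_λ) = 0 for λ ≠ 0; (iii) H_0 = k·1_H; and (iv) Δ: H → (H⊗H)_χ is a homomorphism of unital algebras, where (H⊗H)_χ denotes H ⊗_k H with the twisted multiplication (a₁⊗a₂) *_χ (b₁⊗b₂) = c^{χ'(|a₂|,|b₁|)+χ''(|a₁|,|b₂|)} a₁b₁ ⊗ a₂b₂ on homogeneous elements. Then there exists a k-linear map S: H → H (an antipode) such that ∇ ∘ (id ⊗ S) ∘ Δ = η ∘ ε = ∇ ∘ (S ⊗ id) ∘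 Δ. -/
open TensorProduct

section GradedConvolution

open LinearMap WithConv Coalgebra

variable {k C A ι : Type*} [CommRing k] [AddCommGroup C] [Module k C] [Coalgebra k C]
  [Ring A] [Algebra k A] [AddCommMonoid ι] {𝒞 : ι → Submodule k C}

/-- The comultiplication sends `𝒞 l` into the sum of the `𝒞 m ⊗ 𝒞 n` with `m + n = l`. -/
def IsGradedComul (𝒞 : ι → Submodule k C) : Prop :=
  ∀ l : ι, ∀ x ∈ 𝒞 l, comul x ∈ Submodule.span k {t : C ⊗[k] C | ∃ (m n : ι) (a b : C),
    m + n = l ∧ a ∈ 𝒞 m ∧ b ∈ 𝒞 n ∧ t = a ⊗ₜ[k] b}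

theorem IsGradedComul.convMul_congr (h : IsGradedComul 𝒞) {f g f' g' : WithConv (C →ₗ[k] A)}
    {l : ι} {x : C} (hx : x ∈ 𝒞 l)
    (hfg : ∀ m n : ι, m + n = l → ∀ a ∈ 𝒞 m, ∀ b ∈ 𝒞 n, f a * g b = f' a * g' b) :
    (f * g) x = (f' * g') x := by
  rw [convMul_apply, convMul_apply]
  refine LinearMap.eqOn_span (f := mul' k A ∘ₗ TensorProduct.map f.ofConv g.ofConv)
    (g := mul' k A ∘ₗ TensorProduct.map f'.ofConv g'.ofConv) ?_ (h l x hx)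
  rintro _ ⟨m, n, a, b, hmn, ha, hb, rfl⟩
  simpa using hfg m n hmn a ha b hb

theorem IsGradedComul.convPow_apply_eq_zero (h : IsGradedComul 𝒞) (d : ι →+ ℕ)
    (hd : ∀ l, d l = 0 → l = 0) {p : WithConv (C →ₗ[k] A)} (hp : ∀ x ∈ 𝒞 0, p x = 0) :
    ∀ (n : ℕ) (l : ι), d l < n → ∀ x ∈ 𝒞 l, (p ^ n) x = 0 := by
  intro n
  induction n with
  | zero => intro l hl; omega
  | succ n ih =>
    intro l hl x hx
    rw [pow_succ', h.convMul_congr (f' := 0) (g' := 0) hx, zero_mul]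
    · rfl
    rintro m m' rfl a ha b hb
    rw [map_add] at hl
    by_cases hm : d m = 0
    · rw [hp a (hd m hm ▸ ha)]; simp
    · rw [ih m' (by omega) b hb]; simp

/-- A linear map from a connected graded coalgebra to an algebra which agrees with the
convolution unit in degree zero is convolution invertible. -/
theorem IsGradedComul.isUnit_conv [DecidableEq ι] [DirectSum.Decomposition 𝒞]
    (h : IsGradedComul 𝒞) (d : ι →+ ℕ) (hd : ∀ l, d l = 0 → l = 0)
    {f : WithConv (C →ₗ[k] A)} (hf : ∀ x ∈ 𝒞 0, f x = (1 : WithConv (C →ₗ[k] A)) x) :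
    IsUnit f := by
  obtain ⟨p, rfl⟩ : ∃ p, f = 1 - p := ⟨1 - f, by abel⟩
  have hp : ∀ x ∈ 𝒞 0, p x = 0 := fun x hx ↦ sub_eq_self.mp (hf x hx)
  have hpow := h.convPow_apply_eq_zero d hd hp
  let G (N : ℕ) : WithConv (C →ₗ[k] A) := ∑ i ∈ Finset.range N, p ^ i
  have hGsucc (N : ℕ) : G (N + 1) = G N + p ^ N := Finset.sum_range_succ _ _
  have hG (N : ℕ) (l : ι) (hl : d l < N) (x : C) (hx : x ∈ 𝒞 l) :
      G N x = G (d l + 1) x := by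
    induction N, Nat.succ_le_of_lt hl using Nat.le_induction with
    | base => rfl
    | succ N hN ih =>
      rw [hGsucc, ← ih hN]
      change G N x + (p ^ N) x = _
      rw [hpow N l hN x hx, add_zero]
  let S : WithConv (C →ₗ[k] A) := toConv <|
    DirectSum.toModule k ι A (fun l ↦ (G (d l + 1)).ofConv ∘ₗ (𝒞 l).subtype) ∘ₗ
      (DirectSum.decomposeLinearEquiv 𝒞).toLinearMap
  have hS (N : ℕ) (l : ι) (hl : d l < N) (x : C) (hx : x ∈ 𝒞 l) : S x = G N x := by
    lift x to 𝒞 l using hx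
    rw [hG N l hl x x.2]
    change DirectSum.toModule k ι A _ (DirectSum.decomposeLinearEquiv 𝒞 (x : C)) = _
    rw [DirectSum.decomposeLinearEquiv_apply_coe, DirectSum.toModule_lof]
    rfl
  have ext_conv {u v : WithConv (C →ₗ[k] A)} (huv : ∀ l, ∀ x ∈ 𝒞 l, u x = v x) : u = v :=
    WithConv.ext <| DirectSum.decompose_lhom_ext 𝒞 fun l ↦
      LinearMap.ext fun x ↦ huv l x x.2
  have key {u : WithConv (C →ₗ[k] A)} {l : ι} {x : C} (hx : x ∈ 𝒞 l)
      (hu : u = 1 - p ^ (d l + 1)) : u x = (1 : WithConv (C →ₗ[k] A)) x := by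
    subst hu
    exact sub_eq_self.mpr (hpow _ l (Nat.lt_succ_self _) x hx)
  refine isUnit_iff_exists.mpr ⟨S, ext_conv fun l x hx ↦ ?_, ext_conv fun l x hx ↦ ?_⟩
  · rw [← key hx (mul_neg_geom_sum p _)]
    refine h.convMul_congr hx ?_
    rintro m n rfl a - b hb
    rw [hS (d (m + n) + 1) n (by rw [map_add]; omega) b hb]
  · rw [← key hx (geom_sum_mul_neg p _)]
    refine h.convMul_congr hx ?_
    rintro m n rfl a ha b -
    rw [hS (d (m + n) + 1) m (by rw [map_add]; omega) a ha]

end GradedConvolution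

/-- A `Λ`-graded connected `(c,χ)`-twisted bialgebra (with `Λ = ℕ^r`)
always admits an antipode `S` with `∇ ∘ (id ⊗ S) ∘ Δ = η ∘ ε = ∇ ∘ (S ⊗ id) ∘ Δ`;
that is, it is a twisted Hopf algebra. -/
theorem stmt1 (k : Type*) [CommRing k] (r : ℕ) (hr : 1 ≤ r)
    (H : Type*) [Ring H] [Algebra k H]
    (𝒜 : (Fin r → ℕ) → Submodule k H) [GradedAlgebra 𝒜]
    (c : kˣ) (χ' χ'' : (Fin r → ℕ) → (Fin r → ℕ) → ℤ)
    (hχ'₁ : ∀ a b x : Fin r → ℕ, χ' (a + b) x = χ' a x + χ' b x)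
    (hχ'₂ : ∀ x a b : Fin r → ℕ, χ' x (a + b) = χ' x a + χ' x b)
    (hχ''₁ : ∀ a b x : Fin r → ℕ, χ'' (a + b) x = χ'' a x + χ'' b x)
    (hχ''₂ : ∀ x a b : Fin r → ℕ, χ'' x (a + b) = χ'' x a + χ'' x b)
    -- the twisted multiplication on `H ⊗ H`
    (star : H ⊗[k] H →ₗ[k] H ⊗[k] H →ₗ[k] H ⊗[k] H)
    (hstar : ∀ (l₁ l₂ m₁ m₂ : Fin r → ℕ) (a₁ a₂ b₁ b₂ : H),
      a₁ ∈ 𝒜 l₁ → a₂ ∈ 𝒜 l₂ → b₁ ∈ 𝒜 m₁ → b₂ ∈ 𝒜 m₂ →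
      star (a₁ ⊗ₜ[k] a₂) (b₁ ⊗ₜ[k] b₂) =
        ((c ^ (χ' l₂ m₁ + χ'' l₁ m₂) : kˣ) : k) • ((a₁ * b₁) ⊗ₜ[k] (a₂ * b₂)))
    -- the comultiplication and counit
    (Δ : H →ₗ[k] H ⊗[k] H) (ε : H →ₗ[k] k)
    (hcoassoc : (TensorProduct.assoc k H H H).toLinearMap ∘ₗ
        (TensorProduct.map Δ (LinearMap.id : H →ₗ[k] H)) ∘ₗ Δ
      = (TensorProduct.map (LinearMap.id : H →ₗ[k] H) Δ) ∘ₗ Δ)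
    (hcounitl : (TensorProduct.lid k H).toLinearMap ∘ₗ
        (TensorProduct.map ε (LinearMap.id : H →ₗ[k] H)) ∘ₗ Δ = LinearMap.id)
    (hcounitr : (TensorProduct.rid k H).toLinearMap ∘ₗ
        (TensorProduct.map (LinearMap.id : H →ₗ[k] H) ε) ∘ₗ Δ = LinearMap.id)
    -- the comultiplication is graded
    (hΔgr : ∀ lam : Fin r → ℕ, ∀ x ∈ 𝒜 lam,
      Δ x ∈ Submodule.span k {t : H ⊗[k] H | ∃ (μ ν : Fin r → ℕ) (a b : H),
        μ + ν = lam ∧ a ∈ 𝒜 μ ∧ b ∈ 𝒜 ν ∧ t = a ⊗ₜ[k] b})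
    -- the counit vanishes in nonzero degrees
    (hε0 : ∀ lam : Fin r → ℕ, lam ≠ 0 → ∀ x ∈ 𝒜 lam, ε x = 0)
    -- connectedness: `H₀ = k·1`
    (hconn : 𝒜 0 = Submodule.span k {(1 : H)})
    -- `Δ : H → (H ⊗ H)_χ` is a homomorphism of unital algebras
    (hΔ1 : Δ 1 = (1 : H) ⊗ₜ[k] (1 : H))
    (hΔmul : ∀ x y : H, Δ (x * y) = star (Δ x) (Δ y)) :
    ∃ S : H →ₗ[k] H, ∀ x : H,
      LinearMap.mul' k H (TensorProduct.map (LinearMap.id : H →ₗ[k] H) S (Δ x))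
          = ε x • (1 : H) ∧
      LinearMap.mul' k H (TensorProduct.map S (LinearMap.id : H →ₗ[k] H) (Δ x))
          = ε x • (1 : H) := by
  let _ : Coalgebra k H :=
    { comul := Δ
      counit := ε
      coassoc := hcoassoc
      rTensor_counit_comp_comul := LinearMap.ext fun x ↦
        (TensorProduct.lid k H).injective (by simpa [LinearMap.rTensor] using LinearMap.congr_fun hcounitl x)
      lTensor_counit_comp_comul := LinearMap.ext fun x ↦
        (TensorProduct.rid k H).injective (by simpa [LinearMap.lTensor] using LinearMap.congr_fun hcounitr x) }
  have hε1 : ε 1 • (1 : H) = 1 := by simpa [hΔ1] using LinearMap.congr_fun hcounitl 1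
  let d : (Fin r → ℕ) →+ ℕ :=
    { toFun := fun l ↦ ∑ i, l i
      map_zero' := by simp
      map_add' := fun _ _ ↦ Finset.sum_add_distrib }
  have hd (l : Fin r → ℕ) (hl : d l = 0) : l = 0 :=
    funext fun i ↦ Finset.sum_eq_zero_iff.mp hl i (Finset.mem_univ i)
  have hid : ∀ x ∈ 𝒜 0, WithConv.toConv (LinearMap.id : H →ₗ[k] H) x =
      (1 : WithConv (H →ₗ[k] H)) x := by
    intro x hx
    rw [hconn] at hx
    obtain ⟨a, rfl⟩ := Submodule.mem_span_singleton.mp hx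
    change a • (1 : H) = algebraMap k H (ε (a • 1))
    rw [Algebra.algebraMap_eq_smul_one, map_smul, smul_assoc, hε1]
  have hgr : IsGradedComul 𝒜 := hΔgr
  obtain ⟨S, hS, hS'⟩ := isUnit_iff_exists.mp (hgr.isUnit_conv d hd hid)
  refine ⟨S.ofConv, fun x ↦ ⟨?_, ?_⟩⟩
  · rw [← Algebra.algebraMap_eq_smul_one]
    exact congrArg (fun u : WithConv (H →ₗ[k] H) ↦ u x) hS
  · rw [← Algebra.algebraMap_eq_smul_one]
    exact congrArg (fun u : WithConv (H →ₗ[k] H) ↦ u x) hS'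
end

section
/- Fix n, m, k, ℓ ∈ ℕ with n + m = k + ℓ = K, and let r be an integer with max(0, n−ℓ) ≤ r ≤ min(n, k). Define w_r: {1,…,K} → {1,…,K} by w_r(i) = i for 1 ≤ i ≤ r; w_r(i) = i − r + k for r < i ≤ n; w_r(i) = i − n + r for n < i ≤ n + k − r; and w_r(i) = i for n + k − r < i ≤ K. Then w_r is a well-defined permutation of {1,…,K}, and its number of inversions is ℓ(w_r) = (n−r)(k−r). -/
/-- The number of inversions `ℓ(w)` of a permutation `w`. -/
def inversions {n : ℕ} (w : Equiv.Perm (Fin n)) : ℕ :=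
  (Finset.univ.filter (fun p : Fin n × Fin n => p.1 < p.2 ∧ w p.2 < w p.1)).card

/-- The defining recipe for the permutation `w_r`, written with 0-based indices:
position `i` (0-based) corresponds to position `i+1` (1-based) in the paper. -/
def wrFun (n k r : ℕ) (i : ℕ) : ℕ :=
  if i < r then i
  else if i < n then i - r + k
  else if i < n + k - r then i - n + r
  else i

theorem wrFun_lt {n k r K i : ℕ} (hn : r ≤ n) (hK : n + k ≤ r + K) (hi : i < K) :
    wrFun n k r i < K := by
  unfold wrFun
  split_ifs <;> omega

/-- Exchanging `n` and `k` inverts the recipe. -/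
theorem wrFun_wrFun {n k r : ℕ} (hn : r ≤ n) (hk : r ≤ k) (i : ℕ) :
    wrFun k n r (wrFun n k r i) = i := by
  unfold wrFun
  split_ifs <;> omega

/-- The inversions of the recipe pair a position of its second block with one of its third. -/
theorem lt_and_wrFun_lt_iff {n k r : ℕ} (hn : r ≤ n) (hk : r ≤ k) (i j : ℕ) :
    i < j ∧ wrFun n k r j < wrFun n k r i ↔
      (r ≤ i ∧ i < n) ∧ n ≤ j ∧ j < n + k - r := by
  unfold wrFun
  split_ifs <;> omega

/-- The permutation of `Fin K` given by `wrFun n k r`. -/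
def wrPerm {n k r K : ℕ} (hn : r ≤ n) (hk : r ≤ k) (hK : n + k ≤ r + K) :
    Equiv.Perm (Fin K) where
  toFun i := ⟨wrFun n k r i, wrFun_lt hn hK i.isLt⟩
  invFun i := ⟨wrFun k n r i, wrFun_lt hk (by omega) i.isLt⟩
  left_inv i := Fin.ext (wrFun_wrFun hn hk i)
  right_inv i := Fin.ext (wrFun_wrFun hk hn i)

theorem inversions_wrPerm {n k r K : ℕ} (hn : r ≤ n) (hk : r ≤ k) (hK : n + k ≤ r + K) :
    inversions (wrPerm hn hk hK) = (n - r) * (k - r) := by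
  have hmem (p : Fin K × Fin K) : p.1 < p.2 ∧ wrPerm hn hk hK p.2 < wrPerm hn hk hK p.1 ↔
      (r ≤ (p.1 : ℕ) ∧ (p.1 : ℕ) < n) ∧ n ≤ (p.2 : ℕ) ∧ (p.2 : ℕ) < n + k - r :=
    lt_and_wrFun_lt_iff hn hk p.1 p.2
  have hcard : (Finset.Ico r n ×ˢ Finset.Ico n (n + k - r)).card = (n - r) * (k - r) := by
    rw [Finset.card_product, Nat.card_Ico, Nat.card_Ico]
    congr 1
    omega
  rw [← hcard, inversions]
  refine Finset.card_bij (fun p _ => ((p.1 : ℕ), (p.2 : ℕ))) ?_ ?_ ?_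
  · intro p hp
    simpa [hmem] using hp
  · intro p _ q _ h
    simpa [Prod.ext_iff, Fin.ext_iff] using h
  · rintro ⟨i, j⟩ h
    simp only [Finset.mem_product, Finset.mem_Ico] at h
    exact ⟨(⟨i, by omega⟩, ⟨j, by omega⟩),
      Finset.mem_filter.2 ⟨Finset.mem_univ _, (hmem _).2 h⟩, rfl⟩

/-- For `n + m = k + ℓ = K` and `max(0, n−ℓ) ≤ r ≤ min(n,k)`, the recipe
`w_r` is a well-defined permutation of `{1,…,K}` with exactly `(n−r)(k−r)` inversions. -/
theorem stmt10 (n m k l K r : ℕ) (hnm : n + m = K) (hkl : k + l = K)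
    (hr1 : n ≤ r + l) (hr2 : r ≤ n) (hr3 : r ≤ k) :
    ∃ σ : Equiv.Perm (Fin K),
      (∀ i : Fin K, ((σ i : ℕ) = wrFun n k r (i : ℕ))) ∧
      inversions σ = (n - r) * (k - r) :=
  ⟨wrPerm hr2 hr3 (by omega), fun _ => rfl, inversions_wrPerm hr2 hr3 (by omega)⟩
end

section
/- Fix n, m, k, ℓ ∈ ℕ with n + m = k + ℓ = K. Regard S_n × S_m as the subgroup of S_K of permutations preserving both {1,…,n} and {n+1,…,K}, and S_k × S_ℓ as the subgroup of permutations preserving both {1,…,k} and {k+1,…,K}. For each integer r with max(0, n−ℓ) ≤ r ≤ min(n, k), let w_r ∈ S_K be defined by w_r(i) = i for 1 ≤ i ≤ r; w_r(i) = i − r + k for r < i ≤ n; w_r(i) = i − n + r for n < i ≤ n + k − r; and w_r(i) = i for n + k − r < i ≤ K. Then the elements w_r form a complete set of representatives of the double cosets (S_k × S_ℓ) \ S_K / (S_n × S_m): every element of S_K lies in (S_k × S_ℓ)·w_r·(S_n × S_m) for exactly one such r. Moreover each w_r has minimal length in its double coset: ℓ(w_r) ≤ ℓ(w) for every w ∈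 (S_k × S_ℓ)·w_r·(S_n × S_m). -/
/-- A permutation of `Fin K` preserves the block `{1,…,a}` (0-based: `{i : i < a}`);
since permutations are bijections, it then also preserves the complementary block.
The subgroup `S_a × S_{K−a} ≤ S_K` consists of the permutations with this property. -/
def PreservesBlock {K : ℕ} (a : ℕ) (σ : Equiv.Perm (Fin K)) : Prop :=
  ∀ i : Fin K, ((σ i : ℕ) < a ↔ (i : ℕ) < a)

/-- The number of `i < n` with `w i < k`, the invariant which separates the double cosets. -/
def blockCount {K : ℕ} (n k : ℕ) (w : Equiv.Perm (Fin K)) : ℕ :=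
  (Finset.univ.filter fun i : Fin K => (i : ℕ) < n ∧ (w i : ℕ) < k).card

lemma card_filter_apply_val_lt {K k : ℕ} (hk : k ≤ K) (w : Equiv.Perm (Fin K)) :
    (Finset.univ.filter fun i : Fin K => (w i : ℕ) < k).card = k := by
  rw [Finset.card_equiv (t := Finset.univ.filter fun i : Fin K => (i : ℕ) < k) w (by simp),
    Fin.card_filter_val_lt, min_eq_right hk]

lemma blockCount_add_card_le {K n : ℕ} (hn : n ≤ K) (k : ℕ) (w : Equiv.Perm (Fin K)) :
    blockCount n k w +
      (Finset.univ.filter fun i : Fin K => (i : ℕ) < n ∧ ¬ (w i : ℕ) < k).card = n := by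
  have h := Finset.card_filter_add_card_filter_not
    (s := Finset.univ.filter fun i : Fin K => (i : ℕ) < n) (fun i => (w i : ℕ) < k)
  rw [Finset.filter_filter, Finset.filter_filter] at h
  exact h.trans (card_filter_apply_val_lt hn 1)

lemma blockCount_add_card_ge {K k : ℕ} (hk : k ≤ K) (n : ℕ) (w : Equiv.Perm (Fin K)) :
    blockCount n k w +
      (Finset.univ.filter fun i : Fin K => ¬ (i : ℕ) < n ∧ (w i : ℕ) < k).card = k := by
  have h := Finset.card_filter_add_card_filter_not
    (s := Finset.univ.filter fun i : Fin K => (w i : ℕ) < k) (fun i => (i : ℕ) < n)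
  rw [Finset.filter_filter, Finset.filter_filter, card_filter_apply_val_lt hk] at h
  simpa only [blockCount, and_comm] using h

lemma card_not_lt_add_card {K n k : ℕ} (hk : k ≤ K) (w : Equiv.Perm (Fin K)) :
    (Finset.univ.filter fun i : Fin K => (i : ℕ) < n ∧ ¬ (w i : ℕ) < k).card +
      (Finset.univ.filter fun i : Fin K => ¬ (i : ℕ) < n ∧ ¬ (w i : ℕ) < k).card = K - k := by
  have h := Finset.card_filter_add_card_filter_not
    (s := Finset.univ.filter fun i : Fin K => ¬ (w i : ℕ) < k) (fun i => (i : ℕ) < n)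
  have h' := Finset.card_filter_add_card_filter_not
    (s := (Finset.univ : Finset (Fin K))) (fun i => (w i : ℕ) < k)
  rw [card_filter_apply_val_lt hk, Finset.card_univ, Fintype.card_fin] at h'
  rw [Finset.filter_filter, Finset.filter_filter] at h
  simp only [and_comm] at h ⊢
  omega

lemma exists_eq_mul_mul_of_blockCount_eq {K n k : ℕ} (hn : n ≤ K) (hk : k ≤ K)
    {w v : Equiv.Perm (Fin K)} (hwv : blockCount n k w = blockCount n k v) :
    ∃ g h : Equiv.Perm (Fin K), PreservesBlock k g ∧ PreservesBlock n h ∧ w = g * v * h := by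
  let color (u : Equiv.Perm (Fin K)) (i : Fin K) : Bool × Bool :=
    (decide ((i : ℕ) < n), decide ((u i : ℕ) < k))
  have hcard (c : Bool × Bool) :
      Fintype.card {i // color w i = c} = Fintype.card {i // color v i = c} := by
    have hw₁ := blockCount_add_card_le hn k w
    have hv₁ := blockCount_add_card_le hn k v
    have hw₂ := blockCount_add_card_ge hk n w
    have hv₂ := blockCount_add_card_ge hk n v
    have hw₃ := card_not_lt_add_card (n := n) hk w
    have hv₃ := card_not_lt_add_card (n := n) hk v
    rw [Fintype.card_subtype, Fintype.card_subtype]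
    rcases c with ⟨_ | _, _ | _⟩ <;>
      simp only [color, Prod.mk.injEq, decide_eq_true_eq, decide_eq_false_iff_not]
    · omega
    · omega
    · omega
    · exact hwv
  let h : Equiv.Perm (Fin K) := Equiv.ofFiberEquiv fun c => Fintype.equivOfCardEq (hcard c)
  have hh (i : Fin K) : color v (h i) = color w i := Equiv.ofFiberEquiv_map _ i
  simp only [color, Prod.mk.injEq, decide_eq_decide] at hh
  refine ⟨w * h⁻¹ * v⁻¹, h, fun i => ?_, fun i => (hh i).1, by group⟩
  simpa using ((hh (h⁻¹ (v⁻¹ i))).2).symm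

lemma blockCount_mul_mul {K n k : ℕ} {g h : Equiv.Perm (Fin K)} (hg : PreservesBlock k g)
    (hh : PreservesBlock n h) (v : Equiv.Perm (Fin K)) :
    blockCount n k (g * v * h) = blockCount n k v := by
  unfold blockCount
  refine Finset.card_equiv h fun i => ?_
  rw [Finset.mem_filter_univ, Finset.mem_filter_univ, hh i]
  exact and_congr_right' (hg (v (h i)))

lemma card_mul_card_le_inversions {K : ℕ} (n k : ℕ) (w : Equiv.Perm (Fin K)) :
    (Finset.univ.filter fun i : Fin K => (i : ℕ) < n ∧ ¬ (w i : ℕ) < k).card *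
      (Finset.univ.filter fun i : Fin K => ¬ (i : ℕ) < n ∧ (w i : ℕ) < k).card ≤
        inversions w := by
  rw [← Finset.card_product]
  refine Finset.card_le_card fun p hp => ?_
  simp only [Finset.mem_product, Finset.mem_filter, Finset.mem_univ, true_and, Fin.lt_def] at hp ⊢
  omega

lemma blockCount_of_eq_wrFun {n k K r : ℕ} {v : Equiv.Perm (Fin K)} (hrn : r ≤ n) (hrk : r ≤ k)
    (hv : ∀ i : Fin K, (v i : ℕ) = wrFun n k r i) (hn : n ≤ K) : blockCount n k v = r := by
  have h (i : Fin K) : ((i : ℕ) < n ∧ (v i : ℕ) < k) ↔ (i : ℕ) < r := by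
    rw [hv, wrFun]
    split_ifs <;> omega
  simp only [blockCount, h]
  exact card_filter_apply_val_lt (hrn.trans hn) 1

lemma inversions_le_of_eq_wrFun {n k K r : ℕ} {v : Equiv.Perm (Fin K)} (hrn : r ≤ n) (hrk : r ≤ k)
    (hv : ∀ i : Fin K, (v i : ℕ) = wrFun n k r i) :
    inversions v ≤
      (Finset.univ.filter fun i : Fin K => (i : ℕ) < n ∧ ¬ (v i : ℕ) < k).card *
        (Finset.univ.filter fun i : Fin K => ¬ (i : ℕ) < n ∧ (v i : ℕ) < k).card := by
  rw [← Finset.card_product]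
  refine Finset.card_le_card fun p hp => ?_
  simp only [Finset.mem_product, Finset.mem_filter, Finset.mem_univ, true_and, Fin.lt_def, hv,
    wrFun] at hp ⊢
  split_ifs at hp ⊢ <;> omega

/-- For `n + m = k + ℓ = K`, the permutations `w_r`
(`max(0, n−ℓ) ≤ r ≤ min(n,k)`) form a complete set of minimal length representatives of
the double cosets `(S_k × S_ℓ) \ S_K / (S_n × S_m)`. -/
theorem stmt11 (n m k l K : ℕ) (hnm : n + m = K) (hkl : k + l = K)
    (σ : ℕ → Equiv.Perm (Fin K))
    (hσ : ∀ r : ℕ, n ≤ r + l → r ≤ n → r ≤ k →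
      ∀ i : Fin K, ((σ r) i : ℕ) = wrFun n k r (i : ℕ)) :
    ∀ w : Equiv.Perm (Fin K),
      -- each `w` lies in the double coset of `w_r` for exactly one admissible `r`
      (∃! r : ℕ, (n ≤ r + l ∧ r ≤ n ∧ r ≤ k) ∧
        ∃ g h : Equiv.Perm (Fin K), PreservesBlock k g ∧ PreservesBlock n h ∧
          w = g * σ r * h) ∧
      -- and `w_r` has minimal length in its double coset
      (∀ r : ℕ, n ≤ r + l → r ≤ n → r ≤ k →
        (∃ g h : Equiv.Perm (Fin K), PreservesBlock k g ∧ PreservesBlock n h ∧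
          w = g * σ r * h) →
        inversions (σ r) ≤ inversions w) := by
  intro w
  have hn : n ≤ K := by omega
  have hk : k ≤ K := by omega
  refine ⟨⟨blockCount n k w, ?_, ?_⟩, ?_⟩
  · have h₁ := blockCount_add_card_le hn k w
    have h₂ := blockCount_add_card_ge hk n w
    have h₃ := card_not_lt_add_card (n := n) hk w
    have hr : n ≤ blockCount n k w + l ∧ blockCount n k w ≤ n ∧ blockCount n k w ≤ k := by omega
    obtain ⟨hl, hrn, hrk⟩ := hr
    exact ⟨⟨hl, hrn, hrk⟩, exists_eq_mul_mul_of_blockCount_eq hn hk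
      (blockCount_of_eq_wrFun hrn hrk (hσ _ hl hrn hrk) hn).symm⟩
  · rintro r ⟨⟨hl, hrn, hrk⟩, g, h, hg, hh, rfl⟩
    exact (blockCount_of_eq_wrFun hrn hrk (hσ r hl hrn hrk) hn).symm.trans
      (blockCount_mul_mul hg hh (σ r)).symm
  · rintro r hl hrn hrk ⟨g, h, hg, hh, rfl⟩
    refine (inversions_le_of_eq_wrFun hrn hrk (hσ r hl hrn hrk)).trans ?_
    have hc := blockCount_mul_mul hg hh (σ r)
    have hA := blockCount_add_card_le hn k (σ r)
    have hA' := blockCount_add_card_le hn k (g * σ r * h)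
    have hB := blockCount_add_card_ge hk n (σ r)
    have hB' := blockCount_add_card_ge hk n (g * σ r * h)
    refine le_trans (Nat.mul_le_mul ?_ ?_) (card_mul_card_le_inversions n k _) <;> omega
end

section
/- Fix n, m, k, ℓ ∈ ℕ with n + m = k + ℓ = K, regard S_n × S_m and S_k × S_ℓ as subgroups of S_K as follows: S_n × S_m consists of permutations preserving both {1,…,n} and {n+1,…,K}, and S_k × S_ℓ of permutations preserving both {1,…,k} and {k+1,…,K}. For an integer r with max(0, n−ℓ) ≤ r ≤ min(n, k), let w_r ∈ S_K be defined by w_r(i) = i for 1 ≤ i ≤ r; w_r(i) = i − r + k for r < i ≤ n; w_r(i) = i − n + r for n < i ≤ n + k − r; and w_r(i) = i for n + k − r < i ≤ K. Then the double coset C_r = (S_k × S_ℓ)·w_r·(S_n × S_m) has cardinality |C_r| = m!·n!·C(k,r)·C(ℓ, n−r), where C(a,b) denotes the binomial coefficient. -/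
open Finset

section PermCount

variable {α : Type*} [Fintype α] [DecidableEq α]

theorem exists_perm_mem_iff (B S T : Finset α) (h : S.card = T.card)
    (hB : (S ∩ B).card = (T ∩ B).card) :
    ∃ g : Equiv.Perm α, (∀ x, g x ∈ B ↔ x ∈ B) ∧ ∀ x, g x ∈ T ↔ x ∈ S := by
  have hc : ∀ c : Bool × Bool,
      Fintype.card {x // (decide (x ∈ B), decide (x ∈ S)) = c} =
        Fintype.card {x // (decide (x ∈ B), decide (x ∈ T)) = c} := by
    have h1 := card_inter_add_card_sdiff S B
    have h2 := card_inter_add_card_sdiff T B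
    have h3 := card_inter_add_card_sdiff B S
    have h4 := card_inter_add_card_sdiff B T
    have h5 := card_inter_add_card_sdiff Bᶜ S
    have h6 := card_inter_add_card_sdiff Bᶜ T
    have h7 : Bᶜ ∩ S = S \ B := by ext; simp [and_comm]
    have h8 : Bᶜ ∩ T = T \ B := by ext; simp [and_comm]
    rw [inter_comm B] at h3 h4
    rw [h7] at h5
    rw [h8] at h6
    have key : ∀ b s : Bool, ∀ U : Finset α,
        Fintype.card {x // (decide (x ∈ B), decide (x ∈ U)) = (b, s)} =
          (match b, s with
          | true, true => U ∩ B
          | false, true => U \ B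
          | true, false => B \ U
          | false, false => Bᶜ \ U).card := by
      intro b s U
      rw [Fintype.card_subtype]
      congr 1
      cases b <;> cases s <;> ext <;> simp <;> tauto
    rintro ⟨b, s⟩
    rw [key, key]
    cases b <;> cases s <;> simp only <;> omega
  have e := fun c => Fintype.equivOfCardEq (hc c)
  have he := Equiv.ofFiberEquiv_map e
  simp only [Prod.mk.injEq, decide_eq_decide] at he
  exact ⟨Equiv.ofFiberEquiv e, fun x => (he x).1, fun x => (he x).2⟩

theorem card_perm_mem_iff (S T : Finset α) (h : S.card = T.card) :
    (univ.filter fun w : Equiv.Perm α => ∀ x, w x ∈ T ↔ x ∈ S).card =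
      S.card.factorial * Sᶜ.card.factorial := by
  obtain ⟨g, -, hg⟩ := exists_perm_mem_iff univ S T h (by simpa using h)
  have hs := DomMulAct.stabilizer_card (fun x : α => decide (x ∈ S))
  rw [Fintype.prod_bool, Fintype.card_subtype, Fintype.card_subtype, Fintype.card_subtype] at hs
  have h1 : (univ.filter fun x => decide (x ∈ S) = true) = S := by ext; simp
  have h2 : (univ.filter fun x => decide (x ∈ S) = false) = Sᶜ := by ext; simp
  rw [h1, h2] at hs
  rw [← hs]
  refine card_nbij' (fun w => g⁻¹ * w) (fun w => g * w) ?_ ?_ ?_ ?_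
  · intro w hw
    simp only [coe_filter, mem_univ, true_and, Set.mem_ofPred_eq] at hw ⊢
    funext x
    simp [← hg, hw]
  · intro w hw
    simp only [coe_filter, mem_univ, true_and, Set.mem_ofPred_eq] at hw ⊢
    intro x
    simpa [hg] using congrFun hw x
  · intro w _; simp
  · intro w _; simp

theorem card_filter_card_inter (B : Finset α) {n r : ℕ} (hr : r ≤ n) :
    (univ.filter fun T : Finset α => T.card = n ∧ (T ∩ B).card = r).card =
      B.card.choose r * Bᶜ.card.choose (n - r) := by
  rw [← card_powersetCard, ← card_powersetCard, ← card_product]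
  refine card_nbij' (fun T => (T ∩ B, T \ B)) (fun p => p.1 ∪ p.2) ?_ ?_ ?_ ?_
  · intro T hT
    have := card_inter_add_card_sdiff T B
    simp only [coe_filter, mem_univ, true_and, Set.mem_ofPred_eq, coe_product, Set.mem_prod,
      mem_coe, mem_powersetCard] at hT ⊢
    refine ⟨⟨inter_subset_right, hT.2⟩, fun x hx => by simp_all, by omega⟩
  · rintro ⟨P, Q⟩ h
    simp only [coe_filter, mem_univ, true_and, Set.mem_ofPred_eq, coe_product, Set.mem_prod,
      mem_coe, mem_powersetCard] at h ⊢
    obtain ⟨⟨hP, hPc⟩, hQ, hQc⟩ := h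
    have hd : Disjoint P Q := by
      rw [disjoint_left]; intro x hx hx'; simpa [hP hx] using hQ hx'
    refine ⟨by rw [card_union_of_disjoint hd]; omega, ?_⟩
    rw [← hPc]; congr 1; ext x
    have := @hP x; have := @hQ x; simp at *; tauto
  · intro T _; ext; simp; tauto
  · rintro ⟨P, Q⟩ h
    simp only [coe_product, Set.mem_prod, mem_coe, mem_powersetCard] at h
    obtain ⟨⟨hP, -⟩, hQ, -⟩ := h
    simp only [Prod.mk.injEq]
    constructor <;> ext x <;> have := @hP x <;> have := @hQ x <;> simp at * <;> tauto

theorem mem_doubleCoset_iff_card_map_inter (A B : Finset α) (w₀ w : Equiv.Perm α) :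
    (∃ g h : Equiv.Perm α, (∀ x, g x ∈ B ↔ x ∈ B) ∧ (∀ x, h x ∈ A ↔ x ∈ A) ∧
      w = g * w₀ * h) ↔
      (A.map w.toEmbedding ∩ B).card = (A.map w₀.toEmbedding ∩ B).card := by
  constructor
  · rintro ⟨g, h, hg, hh, rfl⟩
    rw [← card_map g.toEmbedding (s := A.map w₀.toEmbedding ∩ B)]
    congr 1
    ext y
    obtain ⟨x, rfl⟩ := (g * w₀ * h).surjective y
    simp [Equiv.Perm.mul_def, hg, hh]
  · intro hc
    obtain ⟨g, hgB, hg⟩ := exists_perm_mem_iff B (A.map w₀.toEmbedding) (A.map w.toEmbedding)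
      (by simp) hc.symm
    refine ⟨g, w₀⁻¹ * g⁻¹ * w, hgB, fun x => ?_, by group⟩
    have := hg (g⁻¹ (w x))
    simpa [mem_map_equiv, ← Equiv.Perm.inv_def] using this.symm

theorem card_filter_card_map_inter (A B : Finset α) {r : ℕ} (hr : r ≤ A.card) :
    (univ.filter fun w : Equiv.Perm α => (A.map w.toEmbedding ∩ B).card = r).card =
      B.card.choose r * Bᶜ.card.choose (A.card - r) * (A.card.factorial * Aᶜ.card.factorial) := by
  rw [← card_filter_card_inter B hr, ← smul_eq_mul (_ : ℕ) (_ * _), ← sum_const,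
    card_eq_sum_card_fiberwise (f := fun w => A.map w.toEmbedding)
      (t := univ.filter fun T : Finset α => T.card = A.card ∧ (T ∩ B).card = r)
      (fun w hw => by simpa using hw)]
  refine sum_congr rfl fun T hT => ?_
  simp only [mem_filter, mem_univ, true_and] at hT
  rw [← card_perm_mem_iff A T hT.1.symm, filter_filter]
  congr 1
  ext w
  simp only [mem_filter, mem_univ, true_and]
  constructor
  · rintro ⟨-, rfl⟩ x
    simp
  · intro h
    have : A.map w.toEmbedding = T := by
      ext y
      simpa [mem_map_equiv] using (h (w.symm y)).symm
    exact ⟨this ▸ hT.2, this⟩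

end PermCount

theorem card_filter_val_lt {a K : ℕ} (h : a ≤ K) :
    (univ.filter fun i : Fin K => (i : ℕ) < a).card = a := by
  rw [Fin.card_filter_val_lt, min_eq_right h]

/-- For `n + m = k + ℓ = K` and `max(0, n−ℓ) ≤ r ≤ min(n,k)`, the double
coset `C_r = (S_k × S_ℓ)·w_r·(S_n × S_m)` has cardinality `m!·n!·C(k,r)·C(ℓ, n−r)`. -/
theorem stmt12 (n m k l K r : ℕ) (hnm : n + m = K) (hkl : k + l = K)
    (hr1 : n ≤ r + l) (hr2 : r ≤ n) (hr3 : r ≤ k)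
    (wr : Equiv.Perm (Fin K))
    (hwr : ∀ i : Fin K, ((wr i : ℕ) = wrFun n k r (i : ℕ))) :
    Set.ncard {w : Equiv.Perm (Fin K) |
        ∃ g h : Equiv.Perm (Fin K), PreservesBlock k g ∧ PreservesBlock n h ∧
          w = g * wr * h} =
      m.factorial * n.factorial * k.choose r * l.choose (n - r) := by
  set A := univ.filter fun i : Fin K => (i : ℕ) < n with hA
  set B := univ.filter fun i : Fin K => (i : ℕ) < k with hB
  have hAc : A.card = n := card_filter_val_lt (by omega)
  have hBc : B.card = k := card_filter_val_lt (by omega)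
  have hAc' : Aᶜ.card = m := by rw [card_compl, hAc, Fintype.card_fin]; omega
  have hBc' : Bᶜ.card = l := by rw [card_compl, hBc, Fintype.card_fin]; omega
  have hw₀ : (A.map wr.toEmbedding ∩ B).card = r := by
    conv_rhs => rw [← card_filter_val_lt (show r ≤ K by omega), ← card_map wr.toEmbedding]
    congr 1
    ext y
    obtain ⟨x, rfl⟩ := wr.surjective y
    have hx := hwr x
    simp only [wrFun] at hx
    simp only [hA, hB, mem_inter, mem_map_equiv, Equiv.symm_apply_apply, mem_filter, mem_univ,
      true_and]
    split_ifs at hx <;> omega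
  have hset : {w : Equiv.Perm (Fin K) | ∃ g h : Equiv.Perm (Fin K),
      PreservesBlock k g ∧ PreservesBlock n h ∧ w = g * wr * h} =
      (univ.filter fun w : Equiv.Perm (Fin K) => (A.map w.toEmbedding ∩ B).card = r) := by
    ext w
    have := mem_doubleCoset_iff_card_map_inter A B wr w
    rw [hw₀] at this
    simpa [PreservesBlock, hA, hB] using this
  rw [hset, Set.ncard_coe_finset, card_filter_card_map_inter A B (by omega), hAc, hBc, hAc', hBc']
  ring
end

section
/- Let F be a field of characteristic ≠ 2, fix (d,ε) ∈ ℤ × ℤ/2, and let N_n be the nilCoxeter graded superalgebra with parameters (d,ε). Let w ∈ S_n with reduced word w = s_{i₁}⋯s_{i_r} (so r = ℓ(w)), and suppose j ∈ {1,…,n−1} satisfies w(j+1) = w(j) + 1. Then in N_n one has (u_{i₁}⋯u_{i_r})·u_j = (−1)^{ε·r} · u_{w(j)} · (u_{i₁}⋯u_{i_r}). -/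
open FreeAlgebra

/-- The defining relations of the nilCoxeter graded superalgebra with parameters `(d,ε)`:
`uᵢ² = 0`, `uᵢuⱼ = (−1)^ε uⱼuᵢ` for `|i−j| > 1`, and the braid relations.
(The generator `uᵢ` of the paper, for `1 ≤ i ≤ n−1`, is indexed here by `i−1 : Fin (n−1)`.) -/
inductive NilCoxeterRel (F : Type) [Field F] (n : ℕ) (ε : ZMod 2) :
    FreeAlgebra F (Fin (n - 1)) → FreeAlgebra F (Fin (n - 1)) → Prop
  | square (i : Fin (n - 1)) :
      NilCoxeterRel F n ε (ι F i * ι F i) 0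
  | comm (i j : Fin (n - 1)) (h : (i : ℕ) + 1 < (j : ℕ)) :
      NilCoxeterRel F n ε (ι F i * ι F j) ((-1 : F) ^ ε.val • (ι F j * ι F i))
  | braid (i j : Fin (n - 1)) (h : (j : ℕ) = (i : ℕ) + 1) :
      NilCoxeterRel F n ε (ι F i * ι F j * ι F i) (ι F j * ι F i * ι F j)

/-- The nilCoxeter graded superalgebra `N_n` with parameters `(d,ε)` (the degree
parameter `d` only enters through the grading). -/
abbrev NilCoxeter (F : Type) [Field F] (n : ℕ) (ε : ZMod 2) :=
  RingQuot (NilCoxeterRel F n ε)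

/-- The generator `u_{i+1}` of the nilCoxeter graded superalgebra. -/
noncomputable def nilCoxeterGen (F : Type) [Field F] (n : ℕ) (ε : ZMod 2)
    (i : Fin (n - 1)) : NilCoxeter F n ε :=
  RingQuot.mkAlgHom F (NilCoxeterRel F n ε) (ι F i)

/-- The product `u_{i₁} ⋯ u_{i_r}` associated to a word `l = [i₁, …, i_r]`. -/
noncomputable def nilCoxeterWord (F : Type) [Field F] (n : ℕ) (ε : ZMod 2)
    (l : List (Fin (n - 1))) : NilCoxeter F n ε :=
  (l.map (nilCoxeterGen F n ε)).prod

/-- The simple reflection `s_{i+1} = (i+1, i+2)` (1-based) as a permutation of `Fin n`. -/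
def simpleRefl {n : ℕ} (i : Fin (n - 1)) : Equiv.Perm (Fin n) :=
  Equiv.swap ⟨(i : ℕ), by have := i.isLt; omega⟩ ⟨(i : ℕ) + 1, by have := i.isLt; omega⟩

/-- `l` is a reduced word for `w`: `w` is the product of the corresponding simple
reflections and the length of `l` is `ℓ(w)`. -/
def IsReducedWord {n : ℕ} (w : Equiv.Perm (Fin n)) (l : List (Fin (n - 1))) : Prop :=
  (l.map simpleRefl).prod = w ∧ l.length = inversions w

/-- The adjacent transposition `(i, i+1)` of `ℕ`. -/
def adjSwap (i k : ℕ) : ℕ := if k = i then i + 1 else if k = i + 1 then i else k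

/-- `ReducedFor f l` says that the reverse of `l` is a reduced word for `f`: composing on the right
with the adjacent transpositions of the word creates a new inversion at each step. -/
inductive ReducedFor {m : ℕ} : (ℕ → ℕ) → List (Fin m) → Prop
  | nil : ReducedFor id []
  | cons {f g : ℕ → ℕ} {l : List (Fin m)} (i : Fin m) (hf : ReducedFor f l)
      (hlt : f i < f (i + 1)) (hg : ∀ k, g k = f (adjSwap i k)) : ReducedFor g (i :: l)

theorem ReducedFor.injective {m : ℕ} {f : ℕ → ℕ} {l : List (Fin m)} (h : ReducedFor f l) :
    Function.Injective f := by
  induction h with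
  | nil => exact Function.injective_id
  | cons i hf hlt hg ih =>
    intro a b hab
    rw [hg, hg] at hab
    have := ih hab
    unfold adjSwap at this
    split_ifs at this <;> omega

section NilCoxeter

variable {F : Type} [Field F] {n : ℕ} {ε : ZMod 2}

theorem nilCoxeterGen_comm (i j : Fin (n - 1)) (h : (i : ℕ) + 1 < j ∨ (j : ℕ) + 1 < i) :
    nilCoxeterGen F n ε i * nilCoxeterGen F n ε j =
      (-1 : F) ^ ε.val • (nilCoxeterGen F n ε j * nilCoxeterGen F n ε i) := by
  have key : ∀ i j : Fin (n - 1), (i : ℕ) + 1 < j →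
      nilCoxeterGen F n ε i * nilCoxeterGen F n ε j =
        (-1 : F) ^ ε.val • (nilCoxeterGen F n ε j * nilCoxeterGen F n ε i) := by
    intro i j h
    simpa [nilCoxeterGen] using
      RingQuot.mkAlgHom_rel F (NilCoxeterRel.comm (F := F) (ε := ε) i j h)
  rcases h with h | h
  · exact key i j h
  · rw [key j i h, smul_smul, ← mul_pow]
    simp

theorem nilCoxeterGen_braid (i j : Fin (n - 1)) (h : (j : ℕ) = i + 1 ∨ (i : ℕ) = j + 1) :
    nilCoxeterGen F n ε i * nilCoxeterGen F n ε j * nilCoxeterGen F n ε i =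
      nilCoxeterGen F n ε j * nilCoxeterGen F n ε i * nilCoxeterGen F n ε j := by
  have key : ∀ i j : Fin (n - 1), (j : ℕ) = i + 1 →
      nilCoxeterGen F n ε i * nilCoxeterGen F n ε j * nilCoxeterGen F n ε i =
        nilCoxeterGen F n ε j * nilCoxeterGen F n ε i * nilCoxeterGen F n ε j := by
    intro i j h
    simpa [nilCoxeterGen] using
      RingQuot.mkAlgHom_rel F (NilCoxeterRel.braid (F := F) (ε := ε) i j h)
  rcases h with h | h
  · exact key i j h
  · exact (key j i h).symm

theorem nilCoxeterWord_reverse_cons (i : Fin (n - 1)) (l : List (Fin (n - 1))) :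
    nilCoxeterWord F n ε (i :: l).reverse =
      nilCoxeterWord F n ε l.reverse * nilCoxeterGen F n ε i := by
  simp [nilCoxeterWord]

theorem adjSwap_braid {i j : ℕ} (h : j = i + 1 ∨ i = j + 1) (k : ℕ) :
    adjSwap i (adjSwap j (adjSwap i k)) = adjSwap j (adjSwap i (adjSwap j k)) := by
  unfold adjSwap
  grind

theorem adjSwap_comm {i j : ℕ} (h : i + 1 < j ∨ j + 1 < i) (k : ℕ) :
    adjSwap i (adjSwap j k) = adjSwap j (adjSwap i k) := by
  unfold adjSwap
  grind

variable (F ε) in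
/-- If `j` is a right descent of `f`, then every reduced word for `f` can be replaced by one ending
in `j`, at the cost of a scalar. -/
theorem ReducedFor.exists_eq_smul_of_descent (N : ℕ) :
    ∀ (f : ℕ → ℕ) (l : List (Fin (n - 1))) (j : Fin (n - 1)), l.length ≤ N → ReducedFor f l →
      f (j + 1) < f j → ∃ (l' : List (Fin (n - 1))) (c : F), ReducedFor f (j :: l') ∧
        l.length = l'.length + 1 ∧ nilCoxeterWord F n ε l.reverse =
          c • nilCoxeterWord F n ε (j :: l').reverse := by
  induction N with
  | zero =>
    intro f l j hl h hd
    cases h with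
    | nil => simp at hd
    | cons i hf hlt hg => simp at hl
  | succ N ih =>
    intro f l j hl h hd
    cases h with
    | nil => simp at hd
    | @cons f₁ _ l₁ i hf hlt hg =>
      simp only [List.length_cons, Nat.add_le_add_iff_right] at hl
      rcases eq_or_ne i j with rfl | hij
      · exact ⟨l₁, 1, .cons i hf hlt hg, by simp, by simp⟩
      have hij' : (i : ℕ) ≠ j := fun h => hij (Fin.ext h)
      have hd' := hd
      rw [hg, hg] at hd'
      by_cases hfar : (i : ℕ) + 1 < j ∨ (j : ℕ) + 1 < i
      · have hd₁ : f₁ (j + 1) < f₁ j := by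
          grind [adjSwap]
        obtain ⟨l₂, c, h₂, hlen, hU⟩ := ih f₁ l₁ j hl hf hd₁
        cases h₂ with
        | @cons f₂ _ _ _ hf₂ hlt₂ hg₂ =>
          refine ⟨i :: l₂, c * (-1) ^ ε.val, .cons (f := fun k => f₂ (adjSwap i k)) j
            (.cons i hf₂ ?_ fun _ => rfl) ?_ ?_, by simp [hlen], ?_⟩
          · rw [hg₂, hg₂] at hlt
            grind [adjSwap]
          · grind [adjSwap]
          · intro k
            rw [hg, hg₂, adjSwap_comm (by omega)]
          · rw [nilCoxeterWord_reverse_cons, hU]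
            simp only [nilCoxeterWord_reverse_cons]
            rw [smul_mul_assoc, mul_assoc, nilCoxeterGen_comm j i (by omega), mul_smul_comm,
              smul_smul, mul_assoc]
      · have hadj : (j : ℕ) = i + 1 ∨ (i : ℕ) = j + 1 := by omega
        have hd₁ : f₁ (j + 1) < f₁ j := by
          grind [adjSwap]
        obtain ⟨l₂, c, h₂, hlen, hU⟩ := ih f₁ l₁ j hl hf hd₁
        cases h₂ with
        | @cons f₂ _ _ _ hf₂ hlt₂ hg₂ =>
          have hd₂ : f₂ (i + 1) < f₂ i := by
            simp only [hg₂] at hd' hlt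
            grind [adjSwap]
          obtain ⟨l₃, c', h₃, hlen', hU'⟩ := ih f₂ l₂ i (by omega) hf₂ hd₂
          cases h₃ with
          | @cons f₃ _ _ _ hf₃ hlt₃ hg₃ =>
            simp only [hg₂, hg₃] at hd' hlt hlt₂
            refine ⟨i :: j :: l₃, c * c', .cons
              (f := fun k => f₃ (adjSwap j (adjSwap i k))) j
              (.cons (f := fun k => f₃ (adjSwap j k)) i
                (.cons j hf₃ ?_ fun _ => rfl) ?_ fun _ => rfl) ?_ ?_, by simp [hlen, hlen'], ?_⟩
            · grind [adjSwap]
            · grind [adjSwap]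
            · grind [adjSwap]
            · intro k
              rw [hg, hg₂, hg₃, adjSwap_braid (by omega)]
            · rw [nilCoxeterWord_reverse_cons, hU, nilCoxeterWord_reverse_cons, hU']
              simp only [nilCoxeterWord_reverse_cons, smul_mul_assoc, smul_smul]
              congr 1
              simpa only [mul_assoc] using congrArg (nilCoxeterWord F n ε l₃.reverse * ·)
                (nilCoxeterGen_braid i j hadj)

theorem ReducedFor.word_mul_gen (N : ℕ) :
    ∀ (f : ℕ → ℕ) (l : List (Fin (n - 1))) (j p : Fin (n - 1)), l.length ≤ N → ReducedFor f l →
      f (j + 1) = f j + 1 → (p : ℕ) = f j →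
        nilCoxeterWord F n ε l.reverse * nilCoxeterGen F n ε j = (-1 : F) ^ (ε.val * l.length) •
          (nilCoxeterGen F n ε p * nilCoxeterWord F n ε l.reverse) := by
  induction N with
  | zero =>
    intro f l j p hl h hj hp
    cases h with
    | nil =>
      obtain rfl : p = j := Fin.ext hp
      simp [nilCoxeterWord]
    | cons i hf hlt hg => simp at hl
  | succ N ih =>
    intro f l j p hl h hj hp
    have hinj := h.injective
    cases h with
    | nil =>
      obtain rfl : p = j := Fin.ext hp
      simp [nilCoxeterWord]
    | @cons f₁ _ l₁ i hf hlt hg =>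
      simp only [List.length_cons, Nat.add_le_add_iff_right] at hl
      have hj' := hj
      rw [hg, hg] at hj'
      rcases eq_or_ne i j with rfl | hij
      · grind [adjSwap]
      have hij' : (i : ℕ) ≠ j := fun h => hij (Fin.ext h)
      by_cases hfar : (i : ℕ) + 1 < j ∨ (j : ℕ) + 1 < i
      · have h₁ := ih f₁ l₁ j p hl hf (by grind [adjSwap]) (by grind [adjSwap])
        rw [nilCoxeterWord_reverse_cons, mul_assoc, nilCoxeterGen_comm i j hfar, mul_smul_comm,
          ← mul_assoc, h₁, smul_mul_assoc, smul_smul, ← pow_add, List.length_cons, mul_assoc]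
        congr 2
        ring
      · have hadj : (j : ℕ) = i + 1 ∨ (i : ℕ) = j + 1 := by omega
        have hinj₁ := hf.injective
        have hne : f₁ i ≠ f₁ j := fun h => hij' (hinj₁ h)
        have hne' : f₁ (i + 1) ≠ f₁ (j + 1) := fun h => hij' (by simpa using hinj₁ h)
        have hd₁ : f₁ (j + 1) < f₁ j := by
          grind [adjSwap]
        obtain ⟨l₂, c, h₂, hlen, hU⟩ := hf.exists_eq_smul_of_descent F ε _ f₁ l₁ j le_rfl hd₁
        cases h₂ with
        | @cons f₂ _ _ _ hf₂ hlt₂ hg₂ =>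
          simp only [hg₂] at hj' hlt
          have h₂ := ih f₂ l₂ i p (by omega) hf₂ (by grind [adjSwap])
            (by rw [hp, hg, hg₂]; grind [adjSwap])
          rw [nilCoxeterWord_reverse_cons, hU, nilCoxeterWord_reverse_cons]
          simp only [smul_mul_assoc, mul_smul_comm]
          rw [smul_comm _ c]
          congr 1
          calc _ = nilCoxeterWord F n ε l₂.reverse * (nilCoxeterGen F n ε j *
                nilCoxeterGen F n ε i * nilCoxeterGen F n ε j) := by simp only [mul_assoc]
            _ = nilCoxeterWord F n ε l₂.reverse * nilCoxeterGen F n ε i *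
                (nilCoxeterGen F n ε j * nilCoxeterGen F n ε i) := by
              rw [← nilCoxeterGen_braid i j hadj]; simp only [mul_assoc]
            _ = _ := by
              rw [h₂, List.length_cons, hlen, smul_mul_assoc]
              simp only [mul_assoc]
              congr 1
              rw [show ε.val * (l₂.length + 1 + 1) = ε.val * l₂.length + 2 * ε.val by ring,
                pow_add, pow_mul _ 2]
              simp

end NilCoxeter

/-- The extension of a permutation of `Fin n` to `ℕ` by the identity. -/
def permExtend {n : ℕ} (w : Equiv.Perm (Fin n)) (k : ℕ) : ℕ :=
  if h : k < n then (w ⟨k, h⟩ : ℕ) else k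

theorem simpleRefl_val {n : ℕ} (i : Fin (n - 1)) (a : Fin n) :
    (simpleRefl i a : ℕ) = adjSwap i a := by
  simp only [simpleRefl, Equiv.swap_apply_def, adjSwap, Fin.ext_iff]
  split_ifs <;> rfl

theorem permExtend_mul_simpleRefl {n : ℕ} (w : Equiv.Perm (Fin n)) (i : Fin (n - 1)) (k : ℕ) :
    permExtend (w * simpleRefl i) k = permExtend w (adjSwap i k) := by
  have hi := i.isLt
  by_cases hk : k < n
  · have h : simpleRefl i ⟨k, hk⟩ = ⟨adjSwap i k, by unfold adjSwap; grind⟩ :=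
      Fin.ext (simpleRefl_val i _)
    have hk' : adjSwap i k < n := by unfold adjSwap; grind
    simp [permExtend, hk, hk', h]
  · have : adjSwap i k = k := by unfold adjSwap; grind
    simp [permExtend, hk, this]

theorem permExtend_val {n : ℕ} (w : Equiv.Perm (Fin n)) (a : Fin n) :
    permExtend w a = w a := by
  simp [permExtend]

theorem simpleRefl_mul_self {n : ℕ} (i : Fin (n - 1)) : simpleRefl i * simpleRefl i = 1 :=
  Equiv.swap_mul_self _ _

theorem inversions_mul_simpleRefl_le {n : ℕ} (w : Equiv.Perm (Fin n)) (i : Fin (n - 1)) :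
    inversions (w * simpleRefl i) ≤
      inversions w + if permExtend w i < permExtend w (i + 1) then 1 else 0 := by
  have hi := i.isLt
  set a : Fin n := ⟨i, by omega⟩ with ha
  set b : Fin n := ⟨i + 1, by omega⟩ with hb
  have hwa : permExtend w i = w a := permExtend_val w a
  have hwb : permExtend w (i + 1) = w b := permExtend_val w b
  have hsa : simpleRefl i a = b := Equiv.swap_apply_left _ _
  have hsb : simpleRefl i b = a := Equiv.swap_apply_right _ _
  have hmap : ((Finset.univ.filter fun p : Fin n × Fin n => p.1 < p.2 ∧
      (w * simpleRefl i) p.2 < (w * simpleRefl i) p.1).erase (a, b)).card ≤ inversions w := by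
    refine Finset.card_le_card_of_injOn (fun p => (simpleRefl i p.1, simpleRefl i p.2)) ?_ ?_
    · rintro ⟨x, y⟩ hp
      obtain ⟨hne, hp⟩ := Finset.mem_erase.mp (Finset.mem_coe.mp hp)
      obtain ⟨-, hxy, hw⟩ := Finset.mem_filter.mp hp
      refine Finset.mem_coe.mpr (Finset.mem_filter.mpr ⟨Finset.mem_univ _, ?_, hw⟩)
      dsimp only at hxy ⊢
      rw [Fin.lt_def, simpleRefl_val, simpleRefl_val]
      simp only [ne_eq, Prod.mk.injEq, Fin.ext_iff, ha, hb] at hne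
      rw [Fin.lt_def] at hxy
      unfold adjSwap
      grind
    · rintro ⟨x, y⟩ - ⟨x', y'⟩ - h
      simpa using h
  split_ifs with h
  · exact (Nat.sub_le_iff_le_add.mp Finset.pred_card_le_card_erase).trans
      (Nat.add_le_add_right hmap 1)
  · rw [Finset.erase_eq_of_notMem] at hmap
    · exact hmap
    · rw [hwa, hwb] at h
      simp only [Finset.mem_filter, Equiv.Perm.mul_apply, hsa, hsb, Fin.lt_def]
      omega

theorem inversions_prod_le {n : ℕ} (l : List (Fin (n - 1))) :
    inversions (l.reverse.map simpleRefl).prod ≤ l.length := by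
  induction l with
  | nil =>
    simp only [inversions, List.reverse_nil, List.map_nil, List.prod_nil, List.length_nil,
      Nat.le_zero, Finset.card_eq_zero, Finset.filter_eq_empty_iff, Equiv.Perm.one_apply]
    exact fun _ _ h => lt_asymm h.1 h.2
  | cons i l ih =>
    have := inversions_mul_simpleRefl_le (l.reverse.map simpleRefl).prod i
    simp only [List.reverse_cons, List.map_append, List.map_cons, List.map_nil, List.prod_append,
      List.prod_cons, List.prod_nil, mul_one, List.length_cons]
    split_ifs at this <;> omega

theorem reducedFor_of_length_eq {n : ℕ} (l : List (Fin (n - 1)))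
    (h : l.length = inversions (l.reverse.map simpleRefl).prod) :
    ReducedFor (permExtend (l.reverse.map simpleRefl).prod) l := by
  induction l with
  | nil =>
    have : permExtend (1 : Equiv.Perm (Fin n)) = id := by
      ext k
      simp [permExtend]
    simpa [this] using ReducedFor.nil
  | cons i l ih =>
    have h₁ := inversions_mul_simpleRefl_le (l.reverse.map simpleRefl).prod i
    have h₂ := inversions_prod_le l
    simp only [List.reverse_cons, List.map_append, List.map_cons, List.map_nil, List.prod_append,
      List.prod_cons, List.prod_nil, mul_one, List.length_cons] at h ⊢
    split_ifs at h₁ with hlt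
    · exact .cons i (ih (by omega)) hlt (permExtend_mul_simpleRefl _ i)
    · omega

/-- If `w = s_{i₁}⋯s_{i_r}` is a reduced word and `w(j+1) = w(j) + 1`,
then `u_{i₁}⋯u_{i_r} · u_j = (−1)^{ε·r} · u_{w(j)} · u_{i₁}⋯u_{i_r}` in the nilCoxeter
graded superalgebra `N_n`.  (Positions and values are translated to 0-based indexing:
`pj, pj1 ∈ Fin n` are the positions `j, j+1`, and `wj ∈ Fin (n−1)` is the index of the
generator `u_{w(j)}`.) -/
theorem stmt13 (F : Type) [Field F] (hF : ringChar F ≠ 2) (d : ℤ) (ε : ZMod 2) (n : ℕ)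
    (w : Equiv.Perm (Fin n)) (l : List (Fin (n - 1))) (hl : IsReducedWord w l)
    (j : Fin (n - 1)) (pj pj1 : Fin n)
    (hpj : (pj : ℕ) = (j : ℕ)) (hpj1 : (pj1 : ℕ) = (j : ℕ) + 1)
    (hj : (w pj1 : ℕ) = (w pj : ℕ) + 1)
    (wj : Fin (n - 1)) (hwj : (wj : ℕ) = (w pj : ℕ)) :
    nilCoxeterWord F n ε l * nilCoxeterGen F n ε j =
      (-1 : F) ^ (ε.val * l.length) •
        (nilCoxeterGen F n ε wj * nilCoxeterWord F n ε l) := by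
  have hred := reducedFor_of_length_eq l.reverse (by
    rw [List.reverse_reverse, List.length_reverse, hl.1]; exact hl.2)
  rw [List.reverse_reverse, hl.1] at hred
  have h₀ : permExtend w j = w pj := by rw [← hpj, permExtend_val]
  have h₁ : permExtend w (j + 1) = w pj1 := by rw [← hpj1, permExtend_val]
  simpa using hred.word_mul_gen (F := F) (ε := ε) _ _ _ j wj le_rfl (by rw [h₀, h₁, hj])
    (by rw [h₀, hwj])
end

section
/- Let F be a field of characteristic ≠ 2, fix (d,ε) ∈ ℤ × ℤ/2, and let N_n denote the nilCoxeter graded superalgebra with parameters (d,ε). For all n, m ∈ ℕ: (i) there is a homomorphism of (ℤ×ℤ/2)-graded F-algebras ρ_{n,m}: N_n ⊗ N_m → N_{n+m}, where N_n ⊗ N_m carries the super tensor product multiplication (a₁⊗b₁)(a₂⊗b₂) = (−1)^{b̄₁·ā₂} a₁a₂ ⊗ b₁b₂, determined by ρ_{n,m}(u_i ⊗ 1) = u_i for 1 ≤ i ≤ n−1 and ρ_{n,m}(1 ⊗ u_j) = u_{n+j} for 1 ≤ j ≤ m−1; (ii) via ρ_{n,m}, N_{n+m} is a free left N_n ⊗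 N_m-module and a free right N_n ⊗ N_m-module, in both cases of rank C(n+m, n) (the binomial coefficient). -/
open FreeAlgebra

open TensorProduct

/-- The nilCoxeter relations (with commutation factor `s`) for a sequence of elements of an
algebra. -/
structure IsNilCoxeterSeq {F A : Type*} [Field F] [Ring A] [Algebra F A] (s : F) (u : ℕ → A) :
    Prop where
  sq (i : ℕ) : u i * u i = 0
  comm (i j : ℕ) (h : i + 1 < j) : u i * u j = s • (u j * u i)
  braid (i : ℕ) : u i * u (i + 1) * u i = u (i + 1) * u i * u (i + 1)

section Generic

variable {F A : Type*} [Field F] [Ring A] [Algebra F A]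

theorem adjoin_le_of_mul_right_mem {S : Set A} {M : Submodule F A} (h1 : 1 ∈ M)
    (h : ∀ y ∈ M, ∀ x ∈ S, y * x ∈ M) : Subalgebra.toSubmodule (Algebra.adjoin F S) ≤ M := by
  intro x hx
  have key : ∀ y ∈ M, y * x ∈ M := by
    induction (show x ∈ Algebra.adjoin F S from hx) using Algebra.adjoin_induction with
    | mem x hxS => exact fun y hy => h y hy x hxS
    | algebraMap r =>
      intro y hy
      rw [← Algebra.commutes, ← Algebra.smul_def]
      exact M.smul_mem r hy
    | add a b ha hb iha ihb =>
      intro y hy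
      rw [mul_add]
      exact M.add_mem (iha ha y hy) (ihb hb y hy)
    | mul a b ha hb iha ihb =>
      intro y hy
      rw [← mul_assoc]
      exact ihb hb _ (iha ha y hy)
  simpa using key 1 h1

theorem adjoin_le_of_mul_left_mem {S : Set A} {M : Submodule F A} (h1 : 1 ∈ M)
    (h : ∀ y ∈ M, ∀ x ∈ S, x * y ∈ M) : Subalgebra.toSubmodule (Algebra.adjoin F S) ≤ M := by
  intro x hx
  have key : ∀ y ∈ M, x * y ∈ M := by
    induction (show x ∈ Algebra.adjoin F S from hx) using Algebra.adjoin_induction with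
    | mem x hxS => exact fun y hy => h y hy x hxS
    | algebraMap r =>
      intro y hy
      rw [← Algebra.smul_def]
      exact M.smul_mem r hy
    | add a b ha hb iha ihb =>
      intro y hy
      rw [add_mul]
      exact M.add_mem (iha ha y hy) (ihb hb y hy)
    | mul a b ha hb iha ihb =>
      intro y hy
      rw [mul_assoc]
      exact iha ha _ (ihb hb y hy)
  simpa using key 1 h1

theorem exists_mul_eq_mul_of_adjoin {S : Set A} {Q : Subalgebra F A} {z : A}
    (h : ∀ x ∈ S, ∃ y ∈ Q, x * z = z * y) {x : A} (hx : x ∈ Algebra.adjoin F S) :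
    ∃ y ∈ Q, x * z = z * y := by
  induction hx using Algebra.adjoin_induction with
  | mem x hx => exact h x hx
  | algebraMap r => exact ⟨algebraMap F A r, Q.algebraMap_mem r, Algebra.commutes r z⟩
  | add a b _ _ iha ihb =>
    obtain ⟨y, hy, e⟩ := iha
    obtain ⟨y', hy', e'⟩ := ihb
    exact ⟨y + y', Q.add_mem hy hy', by rw [add_mul, mul_add, e, e']⟩
  | mul a b _ _ iha ihb =>
    obtain ⟨y, hy, e⟩ := iha
    obtain ⟨y', hy', e'⟩ := ihb
    exact ⟨y * y', Q.mul_mem hy hy', by rw [mul_assoc, e', ← mul_assoc, e, mul_assoc]⟩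

/-- The descending product `u (j + l - 1) * ⋯ * u (j + 1) * u j`. -/
def descProd (u : ℕ → A) (j : ℕ) : ℕ → A
  | 0 => 1
  | l + 1 => u (j + l) * descProd u j l

theorem descProd_add (u : ℕ → A) (j l l' : ℕ) :
    descProd u j (l + l') = descProd u (j + l) l' * descProd u j l := by
  induction l' with
  | zero => simp [descProd]
  | succ l' ih => rw [← add_assoc, descProd, ih, descProd, mul_assoc, add_assoc]

theorem descProd_mem {u : ℕ → A} {Q : Subalgebra F A} {j l : ℕ}
    (h : ∀ i, j ≤ i → i < j + l → u i ∈ Q) : descProd u j l ∈ Q := by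
  induction l with
  | zero => exact Q.one_mem
  | succ l ih =>
    exact Q.mul_mem (h _ (by omega) (by omega)) (ih fun i h1 h2 => h i h1 (by omega))

namespace IsNilCoxeterSeq

variable {s : F} {u : ℕ → A}

theorem comm_symm (hu : IsNilCoxeterSeq s u) (hs : s * s = 1) {i j : ℕ} (h : i + 1 < j) :
    u j * u i = s • (u i * u j) := by
  rw [hu.comm i j h, smul_smul, hs, one_smul]

theorem op (hu : IsNilCoxeterSeq s u) (hs : s * s = 1) :
    IsNilCoxeterSeq s (fun i => MulOpposite.op (u i)) where
  sq i := by rw [← MulOpposite.op_mul, hu.sq, MulOpposite.op_zero]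
  comm i j h := by
    rw [← MulOpposite.op_mul, ← MulOpposite.op_mul, ← MulOpposite.op_smul, hu.comm_symm hs h]
  braid i := by
    simp only [← MulOpposite.op_mul, ← mul_assoc, hu.braid i]

theorem descProd_mul_of_lt (hu : IsNilCoxeterSeq s u) (hs : s * s = 1) {i j : ℕ}
    (h : i + 1 < j) (l : ℕ) : descProd u j l * u i = s ^ l • (u i * descProd u j l) := by
  induction l with
  | zero => simp [descProd]
  | succ l ih =>
    rw [descProd, mul_assoc, ih, mul_smul_comm, ← mul_assoc,
      hu.comm_symm hs (show i + 1 < j + l by omega), smul_mul_assoc, smul_smul, pow_succ, mul_assoc]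

theorem descProd_mul_succ (hu : IsNilCoxeterSeq s u) (hs : s * s = 1) {i j l : ℕ}
    (hj : j ≤ i) (hl : i + 1 < j + l) :
    descProd u j l * u (i + 1) = s ^ l • (u i * descProd u j l) := by
  have far : ∀ (l k : ℕ), j + l < k → descProd u j l * u k = s ^ l • (u k * descProd u j l) := by
    intro l
    induction l with
    | zero => simp [descProd]
    | succ l ih =>
      intro k hk
      rw [descProd, mul_assoc, ih k (by omega), mul_smul_comm, ← mul_assoc,
        hu.comm (j + l) k (by omega), smul_mul_assoc, smul_smul, pow_succ, mul_assoc]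
  induction l with
  | zero => omega
  | succ l ih =>
    by_cases h : i + 1 < j + l
    · rw [descProd, mul_assoc, ih h, mul_smul_comm, ← mul_assoc,
        hu.comm_symm hs h, smul_mul_assoc, smul_smul, pow_succ, mul_assoc]
    · obtain ⟨l, rfl⟩ : ∃ k, l = k + 1 := ⟨l - 1, by omega⟩
      obtain rfl : i = j + l := by omega
      rw [descProd, descProd, mul_assoc, mul_assoc, far l _ (by omega), mul_smul_comm,
        mul_smul_comm, ← add_assoc, ← mul_assoc, ← mul_assoc, ← hu.braid]
      simp only [pow_succ, mul_assoc, hs, mul_one]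

/-- The subalgebra generated by `u i` for `i + 1 < b`. -/
def parabolic (F : Type*) {A : Type*} [Field F] [Ring A] [Algebra F A] (u : ℕ → A) (b : ℕ) :
    Subalgebra F A :=
  Algebra.adjoin F (u '' {i | i + 1 < b})

/-- The subalgebra generated by `u i` for `i + 1 < n + m`, `i + 1 ≠ n`. -/
def maxParabolic (F : Type*) {A : Type*} [Field F] [Ring A] [Algebra F A] (u : ℕ → A) (n m : ℕ) :
    Subalgebra F A :=
  Algebra.adjoin F (u '' {i | i + 1 < n + m ∧ i + 1 ≠ n})

theorem gen_mem_maxParabolic {n m i : ℕ} (h : i + 1 < n + m) (h' : i + 1 ≠ n) :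
    u i ∈ maxParabolic F u n m :=
  Algebra.subset_adjoin ⟨i, ⟨h, h'⟩, rfl⟩

theorem parabolic_succ_le (hu : IsNilCoxeterSeq s u) (hs : s * s = 1) (b : ℕ) :
    Subalgebra.toSubmodule (parabolic F u (b + 1)) ≤
      Subalgebra.toSubmodule (parabolic F u b) *
        Submodule.span F {z | ∃ j l, j + l = b ∧ z = descProd u j l} := by
  set M := Subalgebra.toSubmodule (parabolic F u b) *
        Submodule.span F {z | ∃ j l, j + l = b ∧ z = descProd u j l} with hM
  have mem : ∀ p ∈ parabolic F u b, ∀ j l, j + l = b → p * descProd u j l ∈ M :=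
    fun p hp j l h => Submodule.mul_mem_mul hp (Submodule.subset_span ⟨j, l, h, rfl⟩)
  apply adjoin_le_of_mul_right_mem
  · simpa [descProd] using mem 1 (Subalgebra.one_mem _) b 0 rfl
  rintro y hy _ ⟨i, hi, rfl⟩
  replace hi : i < b := by simpa using hi
  suffices M ≤ M.comap (LinearMap.mulRight F (u i)) from this hy
  conv_lhs => rw [hM]
  refine Submodule.mul_le.2 fun p hp z hz => ?_
  suffices Submodule.span F {z | ∃ j l, j + l = b ∧ z = descProd u j l} ≤
      M.comap (LinearMap.mulRight F (u i) ∘ₗ LinearMap.mulLeft F p) from this hz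
  refine Submodule.span_le.2 ?_
  rintro _ ⟨j, l, rfl, rfl⟩
  change p * descProd u j l * u i ∈ M
  rw [mul_assoc]
  have slide : ∀ k, k + 1 < j + l → ∀ c : F,
      descProd u j l * u i = c • (u k * descProd u j l) → p * (descProd u j l * u i) ∈ M := by
    intro k hk c e
    rw [e, mul_smul_comm, ← mul_assoc]
    exact M.smul_mem _ (mem _ (Subalgebra.mul_mem _ hp (Algebra.subset_adjoin ⟨k, hk, rfl⟩)) _ _ rfl)
  rcases lt_trichotomy i j with h | rfl | h
  · by_cases h' : i + 1 = j
    · subst h'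
      have e := descProd_add u i 1 l
      rw [show descProd u i 1 = u i by simp [descProd]] at e
      rw [← e]
      exact mem p hp _ _ (by omega)
    · exact slide i (by omega) _ (hu.descProd_mul_of_lt hs (by omega) l)
  · obtain ⟨l, rfl⟩ : ∃ k, l = 1 + k := ⟨l - 1, by omega⟩
    rw [descProd_add, mul_assoc, show descProd u i 1 = u i by simp [descProd], hu.sq, mul_zero,
      mul_zero]
    exact M.zero_mem
  · obtain ⟨i, rfl⟩ : ∃ k, i = k + 1 := ⟨i - 1, by omega⟩
    exact slide i hi _ (hu.descProd_mul_succ hs (by omega) hi)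

theorem exists_span_mul_maxParabolic (hu : IsNilCoxeterSeq s u) (hs : s * s = 1) (n m : ℕ) :
    ∃ L : List A, L.length = (n + m).choose n ∧
      Subalgebra.toSubmodule (parabolic F u (n + m)) ≤
        Submodule.span F {x | x ∈ L} * Subalgebra.toSubmodule (maxParabolic F u n m) := by
  have base : ∀ n m, (n = 0 ∨ m = 0) → Subalgebra.toSubmodule (parabolic F u (n + m)) ≤
        Submodule.span F {x | x ∈ [(1 : A)]} * Subalgebra.toSubmodule (maxParabolic F u n m) := by
    intro n m h x hx
    rw [← one_mul x]
    refine Submodule.mul_mem_mul (Submodule.subset_span (by simp)) ?_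
    refine Algebra.adjoin_mono (Set.image_mono ?_) hx
    intro i hi
    simp only [Set.mem_ofPred_eq] at hi ⊢
    omega
  induction n generalizing m with
  | zero => exact ⟨[1], by simp, base 0 m (Or.inl rfl)⟩
  | succ n ihn =>
    induction m with
    | zero => exact ⟨[1], by simp, base (n + 1) 0 (Or.inr rfl)⟩
    | succ m ihm =>
      obtain ⟨L₁, hL₁, h₁⟩ := ihm
      obtain ⟨L₂, hL₂, h₂⟩ := ihn (m + 1)
      refine ⟨L₁ ++ L₂.map (· * descProd u n (m + 1)), ?_, ?_⟩
      · rw [List.length_append, List.length_map, hL₁, hL₂,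
          show n + 1 + (m + 1) = (n + m + 1) + 1 by omega, Nat.choose_succ_succ, add_comm]
        congr 2
        omega
      refine (hu.parabolic_succ_le hs (n + 1 + m)).trans (Submodule.mul_le.2 fun p hp z hz => ?_)
      set M := Submodule.span F {x | x ∈ L₁ ++ L₂.map (· * descProd u n (m + 1))} *
        Subalgebra.toSubmodule (maxParabolic F u (n + 1) (m + 1)) with hM
      suffices Submodule.span F {z | ∃ j l, j + l = n + 1 + m ∧ z = descProd u j l} ≤
        M.comap (LinearMap.mulLeft F p) from this hz
      refine Submodule.span_le.2 ?_
      rintro _ ⟨j, l, hjl, rfl⟩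
      suffices ∀ (N : Submodule F A), p ∈ N → N ≤ M.comap (LinearMap.mulRight F (descProd u j l)) →
        p * descProd u j l ∈ M from by
          by_cases hj : n + 1 ≤ j
          · refine this _ (h₁ hp) (Submodule.mul_le.2 fun v hv q hq => ?_)
            change v * q * _ ∈ M
            rw [mul_assoc]
            refine Submodule.mul_mem_mul (Submodule.span_mono (by intro x; simp_all) hv)
              (Subalgebra.mul_mem _ (Algebra.adjoin_mono (Set.image_mono ?_) hq)
                (descProd_mem fun i h h' => gen_mem_maxParabolic (by omega) (by omega)))
            intro i
            simp only [Set.mem_ofPred_eq]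
            omega
          · refine this _ (h₂ (by rwa [show n + (m + 1) = n + 1 + m by omega]))
              (Submodule.mul_le.2 fun v hv q hq => ?_)
            change v * q * _ ∈ M
            obtain ⟨k, rfl⟩ : ∃ k, n = j + k := ⟨n - j, by omega⟩
            obtain rfl : l = k + (m + 1) := by omega
            obtain ⟨y, hy, e⟩ : ∃ y ∈ maxParabolic F u (j + k + 1) (m + 1),
                q * descProd u (j + k) (m + 1) = descProd u (j + k) (m + 1) * y := by
              refine exists_mul_eq_mul_of_adjoin ?_ hq
              rintro _ ⟨i, ⟨hi, hi'⟩, rfl⟩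
              have inv : ∀ x y : A, x = s ^ (m + 1) • y → y = s ^ (m + 1) • x := by
                rintro x y rfl
                rw [smul_smul, ← mul_pow, hs, one_pow, one_smul]
              rcases lt_or_ge i (j + k) with h | h
              · refine ⟨s ^ (m + 1) • u i,
                  Subalgebra.smul_mem _ (gen_mem_maxParabolic (by omega) (by omega)) _, ?_⟩
                rw [mul_smul_comm]
                exact inv _ _ (hu.descProd_mul_of_lt hs (by omega) _)
              · refine ⟨s ^ (m + 1) • u (i + 1),
                  Subalgebra.smul_mem _ (gen_mem_maxParabolic (by omega) (by omega)) _, ?_⟩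
                rw [mul_smul_comm]
                exact inv _ _ (hu.descProd_mul_succ hs h (by omega))
            rw [descProd_add, mul_assoc, ← mul_assoc q, e, mul_assoc, ← mul_assoc v]
            refine Submodule.mul_mem_mul ?_ (Subalgebra.mul_mem _ hy
              (descProd_mem fun i h h' => gen_mem_maxParabolic (by omega) (by omega)))
            suffices Submodule.span F {x | x ∈ L₂} ≤ (Submodule.span F {x | x ∈ L₁ ++
              L₂.map (· * descProd u (j + k) (m + 1))}).comap
                (LinearMap.mulRight F (descProd u (j + k) (m + 1))) from this hv
            refine Submodule.span_le.2 fun x hx => Submodule.subset_span ?_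
            simp only [Set.mem_ofPred_eq, List.mem_append, List.mem_map]
            exact Or.inr ⟨x, hx, rfl⟩
      exact fun N hN hle => hle hN

/-- The operators by which the generators act on a sequence of copies of `A`, the `j`-th copy
standing for the right coset of the ascending product starting at `u j`. -/
def cosetOp (s : F) (u : ℕ → A) (i : ℕ) : Module.End F (ℕ → A) where
  toFun f j := if j = i then f (i + 1) else if j = i + 1 then 0 else
    s ^ j • (u (if j < i then i - 1 else i) * f j)
  map_add' f g := by
    ext j
    simp only [Pi.add_apply]
    split_ifs <;> simp [mul_add]
  map_smul' c f := by
    ext j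
    simp only [Pi.smul_apply, RingHom.id_apply]
    split_ifs <;> simp [smul_comm c]

theorem cosetOp_self (s : F) (u : ℕ → A) (i : ℕ) (f : ℕ → A) :
    cosetOp s u i f i = f (i + 1) := by simp [cosetOp]

theorem cosetOp_succ (s : F) (u : ℕ → A) (i : ℕ) (f : ℕ → A) :
    cosetOp s u i f (i + 1) = 0 := by simp [cosetOp]

theorem cosetOp_lt (s : F) (u : ℕ → A) {i j : ℕ} (h : j ≤ i) (f : ℕ → A) :
    cosetOp s u (i + 1) f j = s ^ j • (u i * f j) := by
  have h1 : j ≠ i + 1 := by omega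
  have h2 : j ≠ i + 1 + 1 := by omega
  simp [cosetOp, h1, h2, h]

theorem cosetOp_gt (s : F) (u : ℕ → A) {i j : ℕ} (h : i + 1 < j) (f : ℕ → A) :
    cosetOp s u i f j = s ^ j • (u i * f j) := by
  have h1 : j ≠ i := by omega
  have h2 : j ≠ i + 1 := by omega
  have h3 : ¬ j < i := by omega
  simp [cosetOp, h1, h2, h3]

theorem isNilCoxeterSeq_cosetOp (hu : IsNilCoxeterSeq s u) (hs : s * s = 1) :
    IsNilCoxeterSeq s (cosetOp s u) where
  sq i := by
    refine LinearMap.ext fun f => funext fun j => ?_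
    change cosetOp s u i (cosetOp s u i f) j = 0
    rcases lt_trichotomy j i with h | rfl | h
    · obtain ⟨i, rfl⟩ : ∃ k, i = k + 1 := ⟨i - 1, by omega⟩
      rw [cosetOp_lt _ _ (by omega), cosetOp_lt _ _ (by omega), mul_smul_comm, ← mul_assoc, hu.sq]
      simp
    · rw [cosetOp_self, cosetOp_succ]
    · rcases eq_or_ne j (i + 1) with rfl | h'
      · rw [cosetOp_succ]
      · rw [cosetOp_gt _ _ (by omega), cosetOp_gt _ _ (by omega), mul_smul_comm, ← mul_assoc, hu.sq]
        simp
  comm i k hik := by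
    refine LinearMap.ext fun f => funext fun j => ?_
    change cosetOp s u i (cosetOp s u k f) j = s • cosetOp s u k (cosetOp s u i f) j
    obtain ⟨k, rfl⟩ : ∃ l, k = l + 1 := ⟨k - 1, by omega⟩
    have hpow : ∀ j : ℕ, s ^ j = s * s ^ (j + 1) := fun j => by
      rw [pow_succ', ← mul_assoc, hs, one_mul]
    rcases lt_trichotomy j i with h | rfl | h
    · obtain ⟨i, rfl⟩ : ∃ k, i = k + 1 := ⟨i - 1, by omega⟩
      rw [cosetOp_lt _ _ (by omega), cosetOp_lt _ _ (by omega), cosetOp_lt _ _ (by omega),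
        cosetOp_lt _ _ (by omega)]
      simp only [mul_smul_comm, ← mul_assoc, hu.comm i k (by omega), smul_mul_assoc]
      simp only [smul_smul]
      congr 1; ring
    · rw [cosetOp_self, cosetOp_lt _ _ (by omega), cosetOp_lt _ _ (by omega), cosetOp_self,
        smul_smul, ← pow_succ']
    · rcases eq_or_ne j (i + 1) with rfl | h'
      · rw [cosetOp_succ, cosetOp_lt _ _ (by omega), cosetOp_succ]
        simp
      rw [cosetOp_gt _ _ (by omega)]
      rcases lt_trichotomy j (k + 1) with h | rfl | h
      · rw [cosetOp_lt _ _ (by omega), cosetOp_lt _ _ (by omega), cosetOp_gt _ _ (by omega)]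
        simp only [mul_smul_comm, ← mul_assoc]
        rw [hu.comm i k (by omega)]
        simp only [smul_mul_assoc, smul_smul]
        congr 1; ring
      · rw [cosetOp_self, cosetOp_self, cosetOp_gt _ _ (by omega), smul_smul, ← hpow]
      · rcases eq_or_ne j (k + 1 + 1) with rfl | h''
        · rw [cosetOp_succ, cosetOp_succ]
          simp
        · rw [cosetOp_gt _ _ (by omega), cosetOp_gt _ _ (by omega), cosetOp_gt _ _ (by omega)]
          simp only [mul_smul_comm, ← mul_assoc]
          rw [hu.comm i (k + 1) (by omega)]
          simp only [smul_mul_assoc, smul_smul]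
          congr 1; ring
  braid i := by
    refine LinearMap.ext fun f => funext fun j => ?_
    change cosetOp s u i (cosetOp s u (i + 1) (cosetOp s u i f)) j =
      cosetOp s u (i + 1) (cosetOp s u i (cosetOp s u (i + 1) f)) j
    rcases lt_trichotomy j i with h | rfl | h
    · obtain ⟨i, rfl⟩ : ∃ k, i = k + 1 := ⟨i - 1, by omega⟩
      simp only [cosetOp_lt s u (show j ≤ i by omega), cosetOp_lt s u (show j ≤ i + 1 by omega),
        mul_smul_comm, ← mul_assoc, hu.braid]
    · rw [cosetOp_self, cosetOp_self, cosetOp_gt _ _ (by omega), cosetOp_lt _ _ le_rfl,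
        cosetOp_self, cosetOp_self, pow_succ, pow_succ, mul_assoc, hs, mul_one]
    · rcases eq_or_ne j (i + 1) with rfl | h'
      · rw [cosetOp_succ, cosetOp_self, cosetOp_gt _ _ (by omega), cosetOp_succ]
        simp
      · rcases eq_or_ne j (i + 1 + 1) with rfl | h''
        · rw [cosetOp_succ, cosetOp_gt _ _ (by omega), cosetOp_succ]
          simp
        · have h1 : i + 1 < j := by omega
          have h2 : i + 1 + 1 < j := by omega
          simp only [cosetOp_gt s u h1, cosetOp_gt s u h2, mul_smul_comm, ← mul_assoc, hu.braid]

theorem cosetOp_single_succ (s : F) (u : ℕ → A) (i : ℕ) (a : A) :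
    cosetOp s u i (Pi.single (i + 1) a) = Pi.single i a := by
  ext j
  by_cases h : j = i <;> by_cases h' : j = i + 1 <;> simp [cosetOp, h, h']

theorem cosetOp_single_gt (s : F) (u : ℕ → A) {i k : ℕ} (h : i + 1 < k) (a : A) :
    cosetOp s u i (Pi.single k a) = s ^ k • Pi.single k (u i * a) := by
  ext j
  rcases eq_or_ne j k with rfl | hj
  · simp [cosetOp_gt s u h]
  · have : i + 1 ≠ k := by omega
    simp [cosetOp, hj, this]

end IsNilCoxeterSeq

end Generic

section Concrete

open IsNilCoxeterSeq

variable (F : Type) [Field F] (n m : ℕ) (ε : ZMod 2)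

theorem neg_one_pow_val_mul_self : ((-1 : F) ^ ε.val) * (-1 : F) ^ ε.val = 1 := by
  rw [← mul_pow]
  simp

/-- The generators of `NilCoxeter F n ε`, extended by zero to a sequence. -/
noncomputable def nilCoxeterSeq (i : ℕ) : NilCoxeter F n ε :=
  if h : i < n - 1 then nilCoxeterGen F n ε ⟨i, h⟩ else 0

variable {n} in
theorem nilCoxeterSeq_coe (i : Fin (n - 1)) :
    nilCoxeterSeq F n ε i = nilCoxeterGen F n ε i := by
  simp [nilCoxeterSeq]

theorem isNilCoxeterSeq_nilCoxeterSeq :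
    IsNilCoxeterSeq ((-1 : F) ^ ε.val) (nilCoxeterSeq F n ε) where
  sq i := by
    unfold nilCoxeterSeq
    split_ifs with h
    · rw [nilCoxeterGen, ← map_mul, RingQuot.mkAlgHom_rel F (NilCoxeterRel.square _), map_zero]
    · simp
  comm i j hij := by
    unfold nilCoxeterSeq
    split_ifs with h h'
    · rw [nilCoxeterGen, nilCoxeterGen, ← map_mul,
        RingQuot.mkAlgHom_rel F (NilCoxeterRel.comm _ _ hij), map_smul, map_mul]
    all_goals simp
  braid i := by
    unfold nilCoxeterSeq
    split_ifs with h h'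
    · rw [nilCoxeterGen, nilCoxeterGen, ← map_mul, ← map_mul,
        RingQuot.mkAlgHom_rel F (NilCoxeterRel.braid _ _ rfl), map_mul, map_mul]
    all_goals simp

theorem adjoin_range_nilCoxeterGen :
    Algebra.adjoin F (Set.range (nilCoxeterGen F n ε)) = ⊤ := by
  have : Set.range (nilCoxeterGen F n ε) =
      RingQuot.mkAlgHom F (NilCoxeterRel F n ε) '' Set.range (ι F) := by
    rw [← Set.range_comp]
    rfl
  rw [this, ← AlgHom.map_adjoin, FreeAlgebra.adjoin_range_ι, Algebra.map_top]
  exact (AlgHom.range_eq_top _).2 (RingQuot.mkAlgHom_surjective _ _)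

variable {F ε} in
/-- The algebra homomorphism out of the nilCoxeter algebra given by a sequence satisfying the
nilCoxeter relations. -/
noncomputable def nilCoxeterLift {A : Type*} [Ring A] [Algebra F A] {u : ℕ → A}
    (hu : IsNilCoxeterSeq ((-1 : F) ^ ε.val) u) : NilCoxeter F n ε →ₐ[F] A :=
  RingQuot.liftAlgHom F ⟨FreeAlgebra.lift F fun i : Fin (n - 1) => u i, by
    rintro _ _ (i | ⟨i, j, h⟩ | ⟨i, j, h⟩)
    · simp [hu.sq]
    · simp [hu.comm _ _ h]
    · simp [h, hu.braid]⟩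

variable {F ε n} in
theorem nilCoxeterLift_gen {A : Type*} [Ring A] [Algebra F A] {u : ℕ → A}
    (hu : IsNilCoxeterSeq ((-1 : F) ^ ε.val) u) (i : Fin (n - 1)) :
    nilCoxeterLift n hu (nilCoxeterGen F n ε i) = u i := by
  simp [nilCoxeterLift, nilCoxeterGen]

theorem IsNilCoxeterSeq.comp_add {A : Type*} [Ring A] [Algebra F A] {s : F} {u : ℕ → A}
    (hu : IsNilCoxeterSeq s u) : IsNilCoxeterSeq s fun i => u (n + i) where
  sq i := hu.sq _
  comm i j h := hu.comm _ _ (by omega)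
  braid i := hu.braid _

theorem parabolic_nilCoxeterSeq : parabolic F (nilCoxeterSeq F n ε) n = ⊤ := by
  rw [← top_le_iff, ← adjoin_range_nilCoxeterGen]
  refine Algebra.adjoin_mono ?_
  rintro _ ⟨i, rfl⟩
  exact ⟨i, by have := i.isLt; simp only [Set.mem_ofPred_eq]; omega, nilCoxeterSeq_coe F ε i⟩

/-- The inclusion of the first tensor factor. -/
noncomputable def nilCoxeterInl : NilCoxeter F n ε →ₐ[F] NilCoxeter F (n + m) ε :=
  nilCoxeterLift n (isNilCoxeterSeq_nilCoxeterSeq F (n + m) ε)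

/-- The inclusion of the second tensor factor. -/
noncomputable def nilCoxeterInr : NilCoxeter F m ε →ₐ[F] NilCoxeter F (n + m) ε :=
  nilCoxeterLift m (IsNilCoxeterSeq.comp_add F n (isNilCoxeterSeq_nilCoxeterSeq F (n + m) ε))

/-- The map `a ⊗ b ↦ a b` from `N_n ⊗ N_m` to `N_{n+m}`. -/
noncomputable def nilCoxeterTensor :
    NilCoxeter F n ε ⊗[F] NilCoxeter F m ε →ₗ[F] NilCoxeter F (n + m) ε :=
  LinearMap.mul' F _ ∘ₗ
    TensorProduct.map (nilCoxeterInl F n m ε).toLinearMap (nilCoxeterInr F n m ε).toLinearMap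

theorem nilCoxeterTensor_tmul (a : NilCoxeter F n ε) (b : NilCoxeter F m ε) :
    nilCoxeterTensor F n m ε (a ⊗ₜ b) = nilCoxeterInl F n m ε a * nilCoxeterInr F n m ε b := by
  simp [nilCoxeterTensor]

variable {F ε n m}

theorem nilCoxeterInl_gen (i : Fin (n - 1)) :
    nilCoxeterInl F n m ε (nilCoxeterGen F n ε i) = nilCoxeterSeq F (n + m) ε i :=
  nilCoxeterLift_gen _ i

theorem nilCoxeterInr_gen (i : Fin (m - 1)) :
    nilCoxeterInr F n m ε (nilCoxeterGen F m ε i) = nilCoxeterSeq F (n + m) ε (n + i) :=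
  nilCoxeterLift_gen _ i

theorem nilCoxeterInr_gen_mul_inl_gen (i : Fin (n - 1)) (j : Fin (m - 1)) :
    nilCoxeterInr F n m ε (nilCoxeterGen F m ε j) * nilCoxeterInl F n m ε (nilCoxeterGen F n ε i) =
      (-1 : F) ^ ε.val • (nilCoxeterInl F n m ε (nilCoxeterGen F n ε i) *
        nilCoxeterInr F n m ε (nilCoxeterGen F m ε j)) := by
  rw [nilCoxeterInl_gen, nilCoxeterInr_gen]
  exact (isNilCoxeterSeq_nilCoxeterSeq F (n + m) ε).comm_symm (neg_one_pow_val_mul_self F ε)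
    (by omega)

theorem nilCoxeterWord_cons (i : Fin (n - 1)) (l : List (Fin (n - 1))) :
    nilCoxeterWord F n ε (i :: l) = nilCoxeterGen F n ε i * nilCoxeterWord F n ε l := by
  simp [nilCoxeterWord]

theorem nilCoxeterInr_word_mul_inl_word (l : List (Fin (n - 1))) (t : List (Fin (m - 1))) :
    nilCoxeterInr F n m ε (nilCoxeterWord F m ε t) *
        nilCoxeterInl F n m ε (nilCoxeterWord F n ε l) =
      ((-1 : F) ^ ε.val) ^ (t.length * l.length) •
        (nilCoxeterInl F n m ε (nilCoxeterWord F n ε l) *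
          nilCoxeterInr F n m ε (nilCoxeterWord F m ε t)) := by
  have single : ∀ (i : Fin (n - 1)) (t : List (Fin (m - 1))),
      nilCoxeterInr F n m ε (nilCoxeterWord F m ε t) *
        nilCoxeterInl F n m ε (nilCoxeterGen F n ε i) =
      ((-1 : F) ^ ε.val) ^ t.length •
        (nilCoxeterInl F n m ε (nilCoxeterGen F n ε i) *
          nilCoxeterInr F n m ε (nilCoxeterWord F m ε t)) := by
    intro i t
    induction t with
    | nil => simp [nilCoxeterWord]
    | cons j t ih =>
      rw [nilCoxeterWord_cons, map_mul, mul_assoc, ih, mul_smul_comm, ← mul_assoc,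
        nilCoxeterInr_gen_mul_inl_gen, smul_mul_assoc, smul_smul, mul_assoc, List.length_cons,
        pow_succ]
  induction l with
  | nil => simp [nilCoxeterWord]
  | cons i l ih =>
    rw [nilCoxeterWord_cons, map_mul, ← mul_assoc, single, smul_mul_assoc, mul_assoc, ih,
      mul_smul_comm, smul_smul, mul_assoc, List.length_cons, ← pow_add]
    congr 2
    ring

theorem span_nilCoxeterWord : Submodule.span F (Set.range (nilCoxeterWord F n ε)) = ⊤ := by
  rw [← top_le_iff, ← Algebra.top_toSubmodule, ← adjoin_range_nilCoxeterGen]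
  refine adjoin_le_of_mul_left_mem (Submodule.subset_span ⟨[], by simp [nilCoxeterWord]⟩) ?_
  rintro y hy _ ⟨i, rfl⟩
  suffices Submodule.span F (Set.range (nilCoxeterWord F n ε)) ≤ (Submodule.span F
    (Set.range (nilCoxeterWord F n ε))).comap (LinearMap.mulLeft F (nilCoxeterGen F n ε i))
    from this hy
  refine Submodule.span_le.2 ?_
  rintro _ ⟨l, rfl⟩
  exact Submodule.subset_span ⟨i :: l, nilCoxeterWord_cons i l⟩

theorem inr_mul_inl_mem_range (a : NilCoxeter F n ε) (b : NilCoxeter F m ε) :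
    nilCoxeterInr F n m ε b * nilCoxeterInl F n m ε a ∈
      LinearMap.range (nilCoxeterTensor F n m ε) := by
  have ha : a ∈ Submodule.span F (Set.range (nilCoxeterWord F n ε)) := by
    simp [span_nilCoxeterWord]
  have hb : b ∈ Submodule.span F (Set.range (nilCoxeterWord F m ε)) := by
    simp [span_nilCoxeterWord]
  induction ha, hb using Submodule.span_induction₂ with
  | mem_mem a b ha hb =>
    obtain ⟨l, rfl⟩ := ha
    obtain ⟨t, rfl⟩ := hb
    rw [nilCoxeterInr_word_mul_inl_word, ← nilCoxeterTensor_tmul]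
    exact Submodule.smul_mem _ _ ⟨_, rfl⟩
  | zero_left => simp
  | zero_right => simp
  | add_left _ _ _ _ _ _ h h' => simpa [mul_add] using add_mem h h'
  | add_right _ _ _ _ _ _ h h' => simpa [add_mul] using add_mem h h'
  | smul_left r _ _ _ _ h => simpa using Submodule.smul_mem _ r h
  | smul_right r _ _ _ _ h => simpa using Submodule.smul_mem _ r h

theorem mul_mem_range_nilCoxeterTensor {x y : NilCoxeter F (n + m) ε}
    (hx : x ∈ LinearMap.range (nilCoxeterTensor F n m ε))
    (hy : y ∈ LinearMap.range (nilCoxeterTensor F n m ε)) :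
    x * y ∈ LinearMap.range (nilCoxeterTensor F n m ε) := by
  obtain ⟨p, rfl⟩ := hx
  obtain ⟨q, rfl⟩ := hy
  induction p with
  | zero => simp
  | add p p' h h' => simpa [add_mul] using add_mem h h'
  | tmul a b =>
    induction q with
    | zero => simp
    | add q q' h h' => simpa [mul_add] using add_mem h h'
    | tmul a' b' =>
      obtain ⟨r, hr⟩ := inr_mul_inl_mem_range a' b
      rw [nilCoxeterTensor_tmul, nilCoxeterTensor_tmul, mul_assoc,
        ← mul_assoc (nilCoxeterInr F n m ε b), ← hr]
      clear hr
      induction r with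
      | zero => simp
      | add r r' h h' => simpa [add_mul, mul_add] using add_mem h h'
      | tmul c d =>
        exact ⟨(a * c) ⊗ₜ (d * b'), by simp [nilCoxeterTensor_tmul, mul_assoc]⟩

theorem one_mem_range_nilCoxeterTensor :
    (1 : NilCoxeter F (n + m) ε) ∈ LinearMap.range (nilCoxeterTensor F n m ε) :=
  ⟨1 ⊗ₜ 1, by simp [nilCoxeterTensor_tmul]⟩

theorem nilCoxeterSeq_mem_range_nilCoxeterTensor {i : ℕ} (hi : i + 1 < n + m) (hn : i + 1 ≠ n) :
    nilCoxeterSeq F (n + m) ε i ∈ LinearMap.range (nilCoxeterTensor F n m ε) := by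
  by_cases h : i < n - 1
  · exact ⟨nilCoxeterGen F n ε ⟨i, h⟩ ⊗ₜ 1, by simp [nilCoxeterTensor_tmul, nilCoxeterInl_gen]⟩
  · obtain ⟨j, rfl⟩ : ∃ j, i = n + j := ⟨i - n, by omega⟩
    exact ⟨1 ⊗ₜ nilCoxeterGen F m ε ⟨j, by omega⟩,
      by simp [nilCoxeterTensor_tmul, nilCoxeterInr_gen]⟩

theorem exists_sum_mul_of_mem_span_mul {A : Type*} [Ring A] [Algebra F A] {k : ℕ} (v : Fin k → A)
    (R : Submodule F A) {x : A} (hx : x ∈ Submodule.span F (Set.range v) * R) :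
    ∃ c : Fin k → R, x = ∑ i, v i * c i := by
  induction hx using Submodule.mul_induction_on' with
  | mem_mul_mem p hp r hr =>
    obtain ⟨c, rfl⟩ := (Submodule.mem_span_range_iff_exists_fun F).1 hp
    exact ⟨fun i => c i • ⟨r, hr⟩, by simp [Finset.sum_mul]⟩
  | add x _ y _ hx hy =>
    obtain ⟨c, rfl⟩ := hx
    obtain ⟨c', rfl⟩ := hy
    exact ⟨c + c', by simp [mul_add, Finset.sum_add_distrib]⟩

theorem exists_fin_family {A : Type*} {L : List A} {k : ℕ} (hL : L.length = k) :
    ∃ v : Fin k → A, Set.range v = {x | x ∈ L} := by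
  subst hL
  exact ⟨L.get, Set.range_list_get L⟩

variable (F ε n m)

theorem exists_right_generators :
    ∃ v : Fin ((n + m).choose n) → NilCoxeter F (n + m) ε, ∀ y,
      ∃ c : Fin ((n + m).choose n) → NilCoxeter F n ε ⊗[F] NilCoxeter F m ε,
        y = ∑ i, v i * nilCoxeterTensor F n m ε (c i) := by
  obtain ⟨L, hL, h⟩ := (isNilCoxeterSeq_nilCoxeterSeq F (n + m) ε).exists_span_mul_maxParabolic
    (neg_one_pow_val_mul_self F ε) n m
  obtain ⟨v, hv⟩ := exists_fin_family hL
  refine ⟨v, fun y => ?_⟩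
  have hQ : Subalgebra.toSubmodule (maxParabolic F (nilCoxeterSeq F (n + m) ε) n m) ≤
      LinearMap.range (nilCoxeterTensor F n m ε) := by
    refine adjoin_le_of_mul_right_mem one_mem_range_nilCoxeterTensor ?_
    rintro y hy _ ⟨i, ⟨hi, hi'⟩, rfl⟩
    exact mul_mem_range_nilCoxeterTensor hy (nilCoxeterSeq_mem_range_nilCoxeterTensor hi hi')
  rw [parabolic_nilCoxeterSeq, ← hv] at h
  obtain ⟨c, hc⟩ := exists_sum_mul_of_mem_span_mul v _
    (mul_le_mul' le_rfl hQ (h (show y ∈ _ from trivial)))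
  choose d hd using fun i => (c i).2
  exact ⟨d, by simp [hd, hc]⟩

theorem exists_left_generators :
    ∃ v : Fin ((n + m).choose n) → NilCoxeter F (n + m) ε, ∀ y,
      ∃ c : Fin ((n + m).choose n) → NilCoxeter F n ε ⊗[F] NilCoxeter F m ε,
        y = ∑ i, nilCoxeterTensor F n m ε (c i) * v i := by
  have hs := neg_one_pow_val_mul_self F ε
  have hu := (isNilCoxeterSeq_nilCoxeterSeq F (n + m) ε).op hs
  obtain ⟨L, hL, h⟩ := hu.exists_span_mul_maxParabolic hs n m
  obtain ⟨v, hv⟩ := exists_fin_family hL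
  refine ⟨fun i => (v i).unop, fun y => ?_⟩
  have hQ : Subalgebra.toSubmodule (maxParabolic F
      (fun i => MulOpposite.op (nilCoxeterSeq F (n + m) ε i)) n m) ≤
      (LinearMap.range (nilCoxeterTensor F n m ε)).comap
        (MulOpposite.opLinearEquiv F).symm.toLinearMap := by
    refine adjoin_le_of_mul_right_mem one_mem_range_nilCoxeterTensor ?_
    rintro y hy _ ⟨i, ⟨hi, hi'⟩, rfl⟩
    exact mul_mem_range_nilCoxeterTensor (nilCoxeterSeq_mem_range_nilCoxeterTensor hi hi') hy
  have hP : MulOpposite.op y ∈ Subalgebra.toSubmodule (parabolic F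
      (fun i => MulOpposite.op (nilCoxeterSeq F (n + m) ε i)) (n + m)) := by
    have hle : Subalgebra.toSubmodule (parabolic F (nilCoxeterSeq F (n + m) ε) (n + m)) ≤
      (Subalgebra.toSubmodule (parabolic F (fun i => MulOpposite.op
        (nilCoxeterSeq F (n + m) ε i)) (n + m))).comap
          (MulOpposite.opLinearEquiv F).toLinearMap := by
      refine adjoin_le_of_mul_right_mem ?_ ?_
      · exact Subalgebra.one_mem (parabolic F (fun i => MulOpposite.op
          (nilCoxeterSeq F (n + m) ε i)) (n + m))
      rintro y hy _ ⟨i, hi, rfl⟩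
      exact Subalgebra.mul_mem (parabolic F (fun i => MulOpposite.op
          (nilCoxeterSeq F (n + m) ε i)) (n + m)) (Algebra.subset_adjoin ⟨i, hi, rfl⟩) hy
    rw [parabolic_nilCoxeterSeq] at hle
    exact hle (show y ∈ _ from trivial)
  rw [← hv] at h
  obtain ⟨c, hc⟩ := exists_sum_mul_of_mem_span_mul v _ (mul_le_mul' le_rfl hQ (h hP))
  choose d hd using fun i => (c i).2
  refine ⟨d, MulOpposite.op_injective ?_⟩
  rw [hc]
  simp [hd]

/-- The action of `N_{k+1}` on the generator of the last coset. -/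
noncomputable def cosetEval (k : ℕ) :
    NilCoxeter F (k + 1) ε →ₗ[F] (ℕ → NilCoxeter F k ε) :=
  LinearMap.applyₗ (Pi.single k 1) ∘ₗ
    (nilCoxeterLift (k + 1) ((isNilCoxeterSeq_nilCoxeterSeq F k ε).isNilCoxeterSeq_cosetOp
      (neg_one_pow_val_mul_self F ε))).toLinearMap

theorem cosetOp_mem_range_cosetEval {k i : ℕ} (hi : i < k) {f : ℕ → NilCoxeter F k ε}
    (hf : f ∈ LinearMap.range (cosetEval F ε k)) :
    cosetOp ((-1 : F) ^ ε.val) (nilCoxeterSeq F k ε) i f ∈ LinearMap.range (cosetEval F ε k) := by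
  obtain ⟨y, rfl⟩ := hf
  exact ⟨nilCoxeterGen F (k + 1) ε ⟨i, hi⟩ * y, by simp [cosetEval, nilCoxeterLift_gen]⟩

theorem single_mem_range_cosetEval {k j : ℕ} (hj : j ≤ k) (a : NilCoxeter F k ε) :
    Pi.single j a ∈ LinearMap.range (cosetEval F ε k) := by
  obtain ⟨l, hl⟩ := Nat.exists_eq_add_of_le hj
  clear hj
  induction l generalizing j with
  | zero =>
    obtain rfl : k = j := hl
    suffices Subalgebra.toSubmodule (parabolic F (nilCoxeterSeq F k ε) k) ≤
        (LinearMap.range (cosetEval F ε k)).comap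
          (LinearMap.single F (fun _ => NilCoxeter F k ε) k) from
      this (by rw [parabolic_nilCoxeterSeq]; trivial)
    refine adjoin_le_of_mul_left_mem ⟨1, by simp [cosetEval]⟩ ?_
    rintro a ha _ ⟨i, hi, rfl⟩
    simp only [Set.mem_ofPred_eq] at hi
    have := Submodule.smul_mem _ (((-1 : F) ^ ε.val) ^ k)
      (cosetOp_mem_range_cosetEval F ε (show i < k by omega) ha)
    rw [LinearMap.single_apply, cosetOp_single_gt _ _ hi, smul_smul, ← mul_pow,
      neg_one_pow_val_mul_self, one_pow, one_smul] at this
    exact this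
  | succ l ih =>
    rw [← cosetOp_single_succ ((-1 : F) ^ ε.val) (nilCoxeterSeq F k ε)]
    exact cosetOp_mem_range_cosetEval F ε (by omega) (ih (by omega))

theorem cosetEval_surjective (k : ℕ) :
    Function.Surjective (LinearMap.funLeft F (NilCoxeter F k ε) (Fin.val : Fin (k + 1) → ℕ) ∘ₗ
      cosetEval F ε k) := by
  intro f
  have : ∑ j : Fin (k + 1), Pi.single (j : ℕ) (f j) ∈ LinearMap.range (cosetEval F ε k) :=
    Submodule.sum_mem _ fun j _ => single_mem_range_cosetEval F ε (by omega) _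
  obtain ⟨y, hy⟩ := this
  refine ⟨y, funext fun j => ?_⟩
  simp [LinearMap.funLeft, hy, Pi.single_apply, Fin.val_inj]

theorem nilCoxeter_finite_finrank_of_le_one (hn : n ≤ 1) :
    Module.Finite F (NilCoxeter F n ε) ∧ Module.finrank F (NilCoxeter F n ε) = 1 := by
  have : IsEmpty (Fin (n - 1)) := by
    rw [Nat.sub_eq_zero_of_le hn]
    infer_instance
  have hbot := adjoin_range_nilCoxeterGen F n ε
  rw [Set.range_eq_empty, Algebra.adjoin_empty] at hbot
  have hu : IsNilCoxeterSeq ((-1 : F) ^ ε.val) (fun _ => (0 : F)) := ⟨by simp, by simp, by simp⟩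
  have : Nontrivial (NilCoxeter F n ε) := (nilCoxeterLift n hu).toRingHom.domain_nontrivial
  have hsurj : Function.Surjective (Algebra.linearMap F (NilCoxeter F n ε)) :=
    Algebra.surjective_algebraMap_iff.2 hbot.symm
  have e := LinearEquiv.ofBijective (Algebra.linearMap F (NilCoxeter F n ε))
    ⟨(algebraMap F (NilCoxeter F n ε)).injective, hsurj⟩
  exact ⟨Module.Finite.equiv e, by rw [← e.finrank_eq, Module.finrank_self]⟩

theorem nilCoxeter_finite_finrank :
    Module.Finite F (NilCoxeter F n ε) ∧ Module.finrank F (NilCoxeter F n ε) = n.factorial := by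
  induction n with
  | zero => exact nilCoxeter_finite_finrank_of_le_one F 0 ε (by omega)
  | succ k ih =>
    obtain ⟨hfin, hk⟩ := ih
    obtain ⟨hfin₁, h₁⟩ := nilCoxeter_finite_finrank_of_le_one F 1 ε le_rfl
    obtain ⟨v, hv⟩ := exists_right_generators F k 1 ε
    let Φ : (Fin ((k + 1).choose k) → NilCoxeter F k ε ⊗[F] NilCoxeter F 1 ε) →ₗ[F]
        NilCoxeter F (k + 1) ε :=
      ∑ i, LinearMap.mulLeft F (v i) ∘ₗ nilCoxeterTensor F k 1 ε ∘ₗ LinearMap.proj i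
    have hΦ : Function.Surjective Φ := fun y => by
      obtain ⟨c, hc⟩ := hv y
      exact ⟨c, by simp [Φ, hc]⟩
    have hfin' := Module.Finite.of_surjective Φ hΦ
    refine ⟨hfin', le_antisymm ?_ ?_⟩
    · refine (LinearMap.finrank_le_finrank_of_surjective hΦ).trans ?_
      simp [Module.finrank_pi_fintype, Module.finrank_tensorProduct, hk, h₁, Nat.factorial_succ]
    · have := LinearMap.finrank_le_finrank_of_surjective (cosetEval_surjective F ε k)
      simpa [Module.finrank_pi_fintype, hk, Nat.factorial_succ] using this

theorem existsUnique_of_surjective {Φ : (Fin ((n + m).choose n) →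
    NilCoxeter F n ε ⊗[F] NilCoxeter F m ε) →ₗ[F] NilCoxeter F (n + m) ε}
    (hΦ : Function.Surjective Φ) (y : NilCoxeter F (n + m) ε) : ∃! c, y = Φ c := by
  obtain ⟨hn, hn'⟩ := nilCoxeter_finite_finrank F n ε
  obtain ⟨hm, hm'⟩ := nilCoxeter_finite_finrank F m ε
  obtain ⟨hnm, hnm'⟩ := nilCoxeter_finite_finrank F (n + m) ε
  have hinj : Function.Injective Φ := by
    refine (LinearMap.injective_iff_surjective_of_finrank_eq_finrank
      (V := Fin ((n + m).choose n) → NilCoxeter F n ε ⊗[F] NilCoxeter F m ε)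
      (V₂ := NilCoxeter F (n + m) ε) (f := Φ) ?_).2 hΦ
    have h := Nat.choose_mul_factorial_mul_factorial (Nat.le_add_right n m)
    rw [Nat.add_sub_cancel_left, mul_assoc] at h
    simp [Module.finrank_pi_fintype, Module.finrank_tensorProduct, hn', hm', hnm', h]
  obtain ⟨c, rfl⟩ := hΦ y
  exact ⟨c, rfl, fun c' h => hinj h.symm⟩

theorem list_prod_mem_of_mem_degree {k : ℕ} {d : ℤ} {𝒜 : ℤ × ZMod 2 → Submodule F (NilCoxeter F k ε)}
    [GradedAlgebra 𝒜] (l : List (NilCoxeter F k ε)) (hl : ∀ x ∈ l, x ∈ 𝒜 (d, ε)) :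
    l.prod ∈ 𝒜 (d * (l.length : ℤ), (l.length : ZMod 2) * ε) := by
  have := SetLike.list_prod_map_mem_graded (A := 𝒜) l (fun _ => (d, ε)) id hl
  simpa [mul_comm] using this

end Concrete


/-- (i) There is a homomorphism of `(ℤ×ℤ/2)`-graded algebras
`ρ_{n,m} : N_n ⊗ N_m → N_{n+m}` (the domain carrying the super tensor product
multiplication) with `ρ(uᵢ⊗1) = uᵢ` and `ρ(1⊗uⱼ) = u_{n+j}`; multiplicativity with
respect to the super product and gradedness are expressed on products of the spanning
words `u_{i₁}⋯u_{i_r}`.  (ii) Via `ρ_{n,m}`, the algebra `N_{n+m}` is a free left and a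
free right `N_n ⊗ N_m`-module of rank `C(n+m, n)`. -/
theorem stmt14 (F : Type) [Field F] (hF : ringChar F ≠ 2) (d : ℤ) (ε : ZMod 2) (n m : ℕ)
    (𝒜 : ℤ × ZMod 2 → Submodule F (NilCoxeter F (n + m) ε)) [GradedAlgebra 𝒜]
    (hgen : ∀ i : Fin (n + m - 1), nilCoxeterGen F (n + m) ε i ∈ 𝒜 (d, ε)) :
    ∃ ρ : NilCoxeter F n ε ⊗[F] NilCoxeter F m ε →ₗ[F] NilCoxeter F (n + m) ε,
      -- `ρ` is unital and sends the generators where it should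
      ρ ((1 : NilCoxeter F n ε) ⊗ₜ[F] (1 : NilCoxeter F m ε)) = 1 ∧
      (∀ i : Fin (n - 1),
        ρ (nilCoxeterGen F n ε i ⊗ₜ[F] (1 : NilCoxeter F m ε)) =
          nilCoxeterGen F (n + m) ε ⟨(i : ℕ), by have := i.isLt; omega⟩) ∧
      (∀ j : Fin (m - 1),
        ρ ((1 : NilCoxeter F n ε) ⊗ₜ[F] nilCoxeterGen F m ε j) =
          nilCoxeterGen F (n + m) ε ⟨n + (j : ℕ), by have := j.isLt; omega⟩) ∧
      -- `ρ` is multiplicative for the super tensor product multiplication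
      (∀ (l₁ l₂ : List (Fin (n - 1))) (t₁ t₂ : List (Fin (m - 1))),
        ρ ((nilCoxeterWord F n ε l₁ * nilCoxeterWord F n ε l₂) ⊗ₜ[F]
            (nilCoxeterWord F m ε t₁ * nilCoxeterWord F m ε t₂)) =
          (-1 : F) ^ (ε.val * t₁.length * (ε.val * l₂.length)) •
            (ρ (nilCoxeterWord F n ε l₁ ⊗ₜ[F] nilCoxeterWord F m ε t₁) *
              ρ (nilCoxeterWord F n ε l₂ ⊗ₜ[F] nilCoxeterWord F m ε t₂))) ∧
      -- `ρ` is graded (homogeneous of degree zero)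
      (∀ (l : List (Fin (n - 1))) (t : List (Fin (m - 1))),
        ρ (nilCoxeterWord F n ε l ⊗ₜ[F] nilCoxeterWord F m ε t) ∈
          𝒜 (d * ((l.length + t.length : ℕ) : ℤ),
            ((l.length + t.length : ℕ) : ZMod 2) * ε)) ∧
      -- `N_{n+m}` is a free left `N_n ⊗ N_m`-module of rank `C(n+m,n)` via `ρ`
      (∃ v : Fin ((n + m).choose n) → NilCoxeter F (n + m) ε,
        ∀ y : NilCoxeter F (n + m) ε,
          ∃! c : Fin ((n + m).choose n) → NilCoxeter F n ε ⊗[F] NilCoxeter F m ε,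
            y = ∑ i : Fin ((n + m).choose n), ρ (c i) * v i) ∧
      -- and a free right `N_n ⊗ N_m`-module of rank `C(n+m,n)` via `ρ`
      (∃ v : Fin ((n + m).choose n) → NilCoxeter F (n + m) ε,
        ∀ y : NilCoxeter F (n + m) ε,
          ∃! c : Fin ((n + m).choose n) → NilCoxeter F n ε ⊗[F] NilCoxeter F m ε,
            y = ∑ i : Fin ((n + m).choose n), v i * ρ (c i)) := by
  have mul_words : ∀ (l₁ l₂ : List (Fin (n - 1))) (t₁ t₂ : List (Fin (m - 1))),
      nilCoxeterTensor F n m ε ((nilCoxeterWord F n ε l₁ * nilCoxeterWord F n ε l₂) ⊗ₜ[F]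
          (nilCoxeterWord F m ε t₁ * nilCoxeterWord F m ε t₂)) =
        (-1 : F) ^ (ε.val * t₁.length * (ε.val * l₂.length)) •
          (nilCoxeterTensor F n m ε (nilCoxeterWord F n ε l₁ ⊗ₜ[F] nilCoxeterWord F m ε t₁) *
            nilCoxeterTensor F n m ε (nilCoxeterWord F n ε l₂ ⊗ₜ[F] nilCoxeterWord F m ε t₂)) := by
    intro l₁ l₂ t₁ t₂
    have hε : ε.val * ε.val = ε.val := by
      have := ε.val_lt
      interval_cases ε.val <;> rfl
    rw [show ε.val * t₁.length * (ε.val * l₂.length) = ε.val * (t₁.length * l₂.length) by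
      rw [mul_mul_mul_comm, hε], pow_mul]
    simp only [nilCoxeterTensor_tmul, map_mul, mul_assoc]
    rw [← mul_assoc (nilCoxeterInr F n m ε (nilCoxeterWord F m ε t₁)),
      nilCoxeterInr_word_mul_inl_word, smul_mul_assoc, mul_smul_comm, smul_smul, ← mul_pow,
      neg_one_pow_val_mul_self, one_pow, one_smul, mul_assoc]
  refine ⟨nilCoxeterTensor F n m ε, by simp [nilCoxeterTensor_tmul], fun i => ?_, fun j => ?_,
    mul_words, fun l t => ?_, ?_, ?_⟩
  · simp only [nilCoxeterTensor_tmul, map_one, mul_one, nilCoxeterInl_gen]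
    exact nilCoxeterSeq_coe F ε (n := n + m) ⟨i, _⟩
  · simp only [nilCoxeterTensor_tmul, map_one, one_mul, nilCoxeterInr_gen]
    exact nilCoxeterSeq_coe F ε (n := n + m) ⟨n + j, _⟩
  · have hseq : ∀ i, nilCoxeterSeq F (n + m) ε i ∈ 𝒜 (d, ε) := by
      intro i
      unfold nilCoxeterSeq
      split_ifs
      · exact hgen _
      · exact zero_mem _
    have := list_prod_mem_of_mem_degree F ε (𝒜 := 𝒜) (d := d)
      (l.map (fun i => nilCoxeterInl F n m ε (nilCoxeterGen F n ε i)) ++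
        t.map (fun j => nilCoxeterInr F n m ε (nilCoxeterGen F m ε j))) (by
        simp only [List.mem_append, List.mem_map]
        rintro _ (⟨i, _, rfl⟩ | ⟨j, _, rfl⟩)
        · rw [nilCoxeterInl_gen]; exact hseq _
        · rw [nilCoxeterInr_gen]; exact hseq _)
    rw [List.length_append, List.length_map, List.length_map, List.prod_append] at this
    rw [nilCoxeterTensor_tmul, nilCoxeterWord, nilCoxeterWord, map_list_prod, map_list_prod,
      List.map_map, List.map_map]
    exact this
  · obtain ⟨v, hv⟩ := exists_left_generators F n m ε
    let Φ : (Fin ((n + m).choose n) → NilCoxeter F n ε ⊗[F] NilCoxeter F m ε) →ₗ[F]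
        NilCoxeter F (n + m) ε :=
      ∑ i, LinearMap.mulRight F (v i) ∘ₗ nilCoxeterTensor F n m ε ∘ₗ LinearMap.proj i
    have hΦ : ∀ c, Φ c = ∑ i, nilCoxeterTensor F n m ε (c i) * v i := fun c => by simp [Φ]
    refine ⟨v, fun y => ?_⟩
    simp only [← hΦ] at hv ⊢
    exact existsUnique_of_surjective F n m ε (fun y => (hv y).imp fun c h => h.symm) y
  · obtain ⟨v, hv⟩ := exists_right_generators F n m ε
    let Φ : (Fin ((n + m).choose n) → NilCoxeter F n ε ⊗[F] NilCoxeter F m ε) →ₗ[F]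
        NilCoxeter F (n + m) ε :=
      ∑ i, LinearMap.mulLeft F (v i) ∘ₗ nilCoxeterTensor F n m ε ∘ₗ LinearMap.proj i
    have hΦ : ∀ c, Φ c = ∑ i, v i * nilCoxeterTensor F n m ε (c i) := fun c => by simp [Φ]
    refine ⟨v, fun y => ?_⟩
    simp only [← hΦ] at hv ⊢
    exact existsUnique_of_surjective F n m ε (fun y => (hv y).imp fun c h => h.symm) y
end
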